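/- arXiv:2202.12625 — 4 statements merged into one kernel-verified Lean document; each statement's English description precedes it below -/
import Mathlib

section
/- Let $(y^i)_{i=1}^M \subset \mathbb{C}^m$ be a frame (with some bounds $0 < A \le B$), $M \ge m$, and let $\tilde{Y} \in \mathbb{C}^{M \times m}$ be any matrix with orthonormal columns ($\tilde{Y}^*\tilde{Y} = I_m$) whose column span contains the column span of the analysis matrix $Y \in \mathbb{C}^{M \times m}$ whose rows are $(y^1)^*, \dots, (y^M)^*$; denote by $\tilde{y}^1, \dots, \tilde{y}^M \in \mathbb{C}^m$ the rows of $\tilde{Y}$. Let $c, p, t \in (0,1)$ and $n \in \mathbb{N}$ with $n \ge \frac{3}{c t^2} m \log(\frac{m}{p})$. Draw $n$ indices $j_1, \dots, j_n \in \{1, \dots, M\}$ i.i.d. according to the probability density $\varrho_i = (1-c)/M + c\, \|\tilde{y}^i\|_2^2 / m$. Then with probability exceeding $1 - p$: for all $a \in \mathbb{C}^m$, $\frac{1}{M} \sum_{i=1}^M |\langle a, y^i \rangle|^2 \le \frac{1}{(1-c)(1-t)} \cdot \frac{1}{n} \sum_{k=1}^n |\langle a, y^{j_k} \rangle|^2$.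 -/
open MeasureTheory Matrix

section

variable {ι : Type*} [Fintype ι]

/-- Simultaneous spectral representation of the quadratic forms and the traces of all powers of a
Hermitian matrix. -/
theorem Matrix.IsHermitian.exists_spectral_weights [DecidableEq ι] {A : Matrix ι ι ℂ} (hA : A.IsHermitian) :
    ∃ (ev : ι → ℝ) (w : (ι → ℂ) → ι → ℝ), (∀ x i, 0 ≤ w x i) ∧
      (∀ x l, star x ⬝ᵥ (A ^ l *ᵥ x) = ((∑ i, ev i ^ l * w x i : ℝ) : ℂ)) ∧
      (∀ l, (A ^ l).trace = ((∑ i, ev i ^ l : ℝ) : ℂ)) ∧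
      (∀ i, ∃ x, w x = Pi.single i 1) := by
  set U : Matrix ι ι ℂ := (hA.eigenvectorUnitary : Matrix ι ι ℂ) with hU
  have hUU : star U * U = 1 := Unitary.coe_star_mul_self hA.eigenvectorUnitary
  have hpow : ∀ l, A ^ l = U * diagonal (fun i => ((hA.eigenvalues i ^ l : ℝ) : ℂ)) * star U := by
    intro l
    conv_lhs => rw [hA.spectral_theorem]
    rw [← map_pow, Unitary.conjStarAlgAut_apply, diagonal_pow]
    congr 3
    ext i
    simp
  refine ⟨hA.eigenvalues, fun x i => ‖(star U *ᵥ x) i‖ ^ 2, fun x i => by positivity, ?_, ?_, ?_⟩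
  · intro x l
    have h1 : star x ⬝ᵥ (A ^ l *ᵥ x) =
        star (star U *ᵥ x) ⬝ᵥ
          (diagonal (fun i => ((hA.eigenvalues i ^ l : ℝ) : ℂ)) *ᵥ (star U *ᵥ x)) := by
      rw [hpow l, star_mulVec, ← dotProduct_mulVec, mulVec_mulVec, mulVec_mulVec]
      simp [star_eq_conjTranspose, Matrix.mul_assoc]
    rw [h1]
    simp only [dotProduct, mulVec_diagonal, Pi.star_apply]
    push_cast
    refine Finset.sum_congr rfl fun i _ => ?_
    rw [← Complex.conj_mul' ((star U *ᵥ x) i)]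
    simp only [RCLike.star_def]
    ring
  · intro l
    rw [hpow l, trace_mul_comm, ← Matrix.mul_assoc, hUU, Matrix.one_mul, trace_diagonal]
    push_cast
    rfl
  · intro i
    refine ⟨U *ᵥ Pi.single i 1, ?_⟩
    ext j
    simp only [mulVec_mulVec, hUU, one_mulVec]
    by_cases h : j = i
    · subst h; simp
    · simp [h]

/-- Weighted Chebyshev inequality for powers of nonnegative numbers. -/
theorem sum_pow_mul_sum_pow_le {a w : ι → ℝ} (ha : ∀ i, 0 ≤ a i) (hw : ∀ i, 0 ≤ w i) (k l : ℕ) :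
    (∑ i, a i ^ k * w i) * (∑ i, a i ^ l * w i) ≤
      (∑ i, w i) * ∑ i, a i ^ (k + l) * w i := by
  have key : 0 ≤ ∑ i, ∑ j, w i * w j * ((a i ^ k - a j ^ k) * (a i ^ l - a j ^ l)) := by
    refine Finset.sum_nonneg fun i _ => Finset.sum_nonneg fun j _ => ?_
    refine mul_nonneg (mul_nonneg (hw i) (hw j)) ?_
    rcases le_total (a i) (a j) with h | h
    · exact mul_nonneg_of_nonpos_of_nonpos (sub_nonpos.2 (pow_le_pow_left₀ (ha i) h k))
        (sub_nonpos.2 (pow_le_pow_left₀ (ha i) h l))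
    · exact mul_nonneg (sub_nonneg.2 (pow_le_pow_left₀ (ha j) h k))
        (sub_nonneg.2 (pow_le_pow_left₀ (ha j) h l))
  have expand : ∑ i, ∑ j, w i * w j * ((a i ^ k - a j ^ k) * (a i ^ l - a j ^ l)) =
      2 * ((∑ i, w i) * ∑ i, a i ^ (k + l) * w i) -
        2 * ((∑ i, a i ^ k * w i) * (∑ i, a i ^ l * w i)) := by
    have h1 : ∀ i j, w i * w j * ((a i ^ k - a j ^ k) * (a i ^ l - a j ^ l)) =
        (a i ^ (k + l) * w i) * w j + w i * (a j ^ (k + l) * w j) -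
          (a i ^ k * w i) * (a j ^ l * w j) - (a i ^ l * w i) * (a j ^ k * w j) := by
      intro i j; ring
    simp only [h1, Finset.sum_sub_distrib, Finset.sum_add_distrib, ← Finset.sum_mul_sum]
    ring
  linarith

/-- A lower bound for arrays satisfying the recursion of the mixed moments
`⟪x, H ^ j (H + x x*) ^ i x⟫`. -/
theorem pow_mul_le_of_mixed_moment_recursion {u : ℕ → ℕ → ℝ} {L r : ℝ} (hr : 0 < r) (hL : 0 ≤ L)
    (hLr : L ≤ r)
    (hrec : ∀ i j, u (i + 1) j = u i (j + 1) + u 0 j * u i 0)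
    (hnonneg : ∀ j, 0 ≤ u 0 j) (hmul : ∀ k l, u 0 k * u 0 l ≤ L * u 0 (k + l))
    (hgrow : ∀ l, r * u 0 l ≤ u 0 (l + 1)) (i j : ℕ) :
    (1 - L / r) ^ j * u (i + j) 0 ≤ u i j := by
  have hpos : ∀ i j, 0 ≤ u i j := by
    intro i
    induction i with
    | zero => exact hnonneg
    | succ i ih =>
      intro j
      rw [hrec]
      exact add_nonneg (ih _) (mul_nonneg (hnonneg _) (ih _))
  have hmul' : ∀ i l j, u i l * u 0 j ≤ L * u i (l + j) := by
    intro i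
    induction i with
    | zero => exact hmul
    | succ i ih =>
      intro l j
      rw [hrec, hrec]
      have h1 := ih (l + 1) j
      have h2 := mul_le_mul_of_nonneg_right (hmul l j) (hpos i 0)
      rw [show l + 1 + j = l + j + 1 by ring] at h1
      nlinarith
  have hgrow' : ∀ i j, r * u i j ≤ u (i + 1) j := by
    intro i
    induction i with
    | zero =>
      intro j
      rw [hrec]
      have := hgrow j
      have := mul_nonneg (hnonneg j) (hnonneg 0)
      linarith
    | succ i ih =>
      intro j
      rw [hrec (i + 1) j, hrec i j]
      have h1 := ih (j + 1)
      have h2 := mul_le_mul_of_nonneg_left (ih 0) (hnonneg j)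
      nlinarith
  have hstep : ∀ i j, (1 - L / r) * u (i + 1) j ≤ u i (j + 1) := by
    intro i j
    have h1 := hrec i j
    have h2 := hmul' i 0 j
    rw [zero_add] at h2
    have h3 : L * u i j ≤ L / r * u (i + 1) j := by
      rw [div_mul_eq_mul_div, le_div_iff₀ hr]
      have := mul_le_mul_of_nonneg_left (hgrow' i j) hL
      linarith
    nlinarith
  have hfac : 0 ≤ 1 - L / r := sub_nonneg.2 ((div_le_one hr).2 hLr)
  induction j generalizing i with
  | zero => simp
  | succ j ih =>
    calc (1 - L / r) ^ (j + 1) * u (i + (j + 1)) 0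
        = (1 - L / r) * ((1 - L / r) ^ j * u (i + 1 + j) 0) := by
          rw [show i + (j + 1) = i + 1 + j by ring]; ring
      _ ≤ (1 - L / r) * u (i + 1) j := mul_le_mul_of_nonneg_left (ih (i + 1)) hfac
      _ ≤ u i (j + 1) := hstep i j

theorem re_star_dotProduct_vecMulVec_mulVec (x v : ι → ℂ) :
    (star v ⬝ᵥ (vecMulVec x (star x) *ᵥ v)).re = ‖star x ⬝ᵥ v‖ ^ 2 := by
  have h : star v ⬝ᵥ (vecMulVec x (star x) *ᵥ v) = star (star x ⬝ᵥ v) * (star x ⬝ᵥ v) := by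
    rw [vecMulVec_mulVec, dotProduct_smul, star_dotProduct v x]
    simp
  rw [h, RCLike.star_def, Complex.conj_mul']
  norm_cast

theorem re_star_dotProduct_self (v : ι → ℂ) : (star v ⬝ᵥ v).re = ∑ i, ‖v i‖ ^ 2 := by
  simp only [dotProduct, Pi.star_apply, RCLike.star_def, Complex.conj_mul', Complex.re_sum]
  exact Finset.sum_congr rfl fun i _ => by norm_cast

theorem norm_star_dotProduct_sq_le (x v : ι → ℂ) :
    ‖star x ⬝ᵥ v‖ ^ 2 ≤ (star x ⬝ᵥ x).re * (star v ⬝ᵥ v).re := by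
  have h := norm_inner_le_norm (𝕜 := ℂ) (WithLp.toLp 2 x) (WithLp.toLp 2 v)
  rw [EuclideanSpace.inner_eq_star_dotProduct, dotProduct_comm] at h
  have h2 := pow_le_pow_left₀ (norm_nonneg _) h 2
  rw [mul_pow, EuclideanSpace.norm_sq_eq, EuclideanSpace.norm_sq_eq] at h2
  rw [re_star_dotProduct_self, re_star_dotProduct_self]
  exact h2

variable [DecidableEq ι]

/-- Telescoping expansion of the trace of a power under a rank-one perturbation. -/
theorem trace_pow_sub_trace_pow_rank_one (H : Matrix ι ι ℂ) (x : ι → ℂ) (q : ℕ) :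
    ((H + vecMulVec x (star x)) ^ q).trace - (H ^ q).trace =
      ∑ i ∈ Finset.range q,
        star x ⬝ᵥ ((H ^ (q - 1 - i) * (H + vecMulVec x (star x)) ^ i) *ᵥ x) := by
  set A := H + vecMulVec x (star x) with hA
  have h := Finset.sum_range_sub (fun i => (A ^ i * H ^ (q - i)).trace) q
  simp only [Nat.sub_self, pow_zero, Matrix.mul_one, Nat.sub_zero, Matrix.one_mul] at h
  rw [← h]
  refine Finset.sum_congr rfl fun i hi => ?_
  have hi' : i < q := Finset.mem_range.1 hi
  rw [show q - i = (q - 1 - i) + 1 by omega, show q - (i + 1) = q - 1 - i by omega, pow_succ A,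
    pow_succ' H, ← trace_sub]
  have h1 : A ^ i * A * H ^ (q - 1 - i) - A ^ i * (H * H ^ (q - 1 - i)) =
      A ^ i * vecMulVec x (star x) * H ^ (q - 1 - i) := by
    rw [show vecMulVec x (star x) = A - H by rw [hA]; abel]
    noncomm_ring
  rw [h1, trace_mul_cycle, mul_vecMulVec, trace_vecMulVec, dotProduct_comm]

/-- Lower bound on the decrease of the trace of a power when a small rank-one matrix is removed. -/
theorem trace_pow_le_of_rank_one {H : Matrix ι ι ℂ} (hH : H.IsHermitian) {x : ι → ℂ} {L r R : ℝ}
    (hr : 0 < r) (hL : 0 ≤ L) (hLr : L ≤ r) (hR : 0 < R) (hx : (star x ⬝ᵥ x).re ≤ L)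
    (hlow : ∀ v, r * (star v ⬝ᵥ v).re ≤ (star v ⬝ᵥ (H *ᵥ v)).re)
    (hup : ∀ v, (star v ⬝ᵥ ((H + vecMulVec x (star x)) *ᵥ v)).re ≤ R * (star v ⬝ᵥ v).re)
    (q : ℕ) :
    (H ^ q).trace.re ≤ ((H + vecMulVec x (star x)) ^ q).trace.re -
      (∑ j ∈ Finset.range q, (1 - L / r) ^ j) / R *
        (star x ⬝ᵥ ((H + vecMulVec x (star x)) ^ q *ᵥ x)).re := by
  have htel := congrArg Complex.re (trace_pow_sub_trace_pow_rank_one H x q)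
  set A := H + vecMulVec x (star x) with hA
  have hAh : A.IsHermitian := by
    refine hH.add ?_
    rw [IsHermitian, conjTranspose_vecMulVec, star_star]
  obtain ⟨ev, w, hw, hform, -, hex⟩ := hH.exists_spectral_weights
  obtain ⟨ev', w', hw', hform', -, hex'⟩ := hAh.exists_spectral_weights
  have hnorm : ∀ v, (star v ⬝ᵥ v).re = ∑ i, w v i := by
    intro v
    have := congrArg Complex.re (hform v 0)
    rwa [pow_zero, one_mulVec, Complex.ofReal_re, Finset.sum_congr rfl
      (fun i _ => by rw [pow_zero, one_mul])] at this
  have hnorm' : ∀ v, (star v ⬝ᵥ v).re = ∑ i, w' v i := by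
    intro v
    have := congrArg Complex.re (hform' v 0)
    rwa [pow_zero, one_mulVec, Complex.ofReal_re, Finset.sum_congr rfl
      (fun i _ => by rw [pow_zero, one_mul])] at this
  have hev : ∀ i, r ≤ ev i := by
    intro i
    obtain ⟨v, hv⟩ := hex i
    have h := hlow v
    have h1 := congrArg Complex.re (hform v 1)
    rw [pow_one] at h1
    rw [hnorm, h1, Complex.ofReal_re, hv] at h
    simpa [Pi.single_apply] using h
  have hev'0 : ∀ i, 0 ≤ ev' i := by
    intro i
    obtain ⟨v, hv⟩ := hex' i
    have h := hlow v
    have h1 := congrArg Complex.re (hform' v 1)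
    rw [pow_one, hA, add_mulVec, dotProduct_add, Complex.add_re,
      re_star_dotProduct_vecMulVec_mulVec, Complex.ofReal_re, hv] at h1
    have h2 : (star v ⬝ᵥ H *ᵥ v).re + ‖star x ⬝ᵥ v‖ ^ 2 = ev' i := by
      simpa [Pi.single_apply] using h1
    have h3 : 0 ≤ r * (star v ⬝ᵥ v).re := by
      rw [re_star_dotProduct_self]; positivity
    exact not_lt.1 fun hlt => by nlinarith [hlow v]
  have hev'R : ∀ i, ev' i ≤ R := by
    intro i
    obtain ⟨v, hv⟩ := hex' i
    have h := hup v
    have h1 := congrArg Complex.re (hform' v 1)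
    rw [pow_one] at h1
    rw [hnorm', h1, Complex.ofReal_re, hv] at h
    simpa [Pi.single_apply] using h
  set u : ℕ → ℕ → ℝ := fun i j => (star x ⬝ᵥ ((H ^ j * A ^ i) *ᵥ x)).re with hu
  have hu0 : ∀ j, u 0 j = ∑ i, ev i ^ j * w x i := by
    intro j
    simp only [hu, pow_zero, Matrix.mul_one, hform, Complex.ofReal_re]
  have hrec : ∀ i j, u (i + 1) j = u i (j + 1) + u 0 j * u i 0 := by
    intro i j
    have hc : star x ⬝ᵥ ((H ^ j * A ^ (i + 1)) *ᵥ x) = star x ⬝ᵥ ((H ^ (j + 1) * A ^ i) *ᵥ x) +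
        (star x ⬝ᵥ (H ^ j *ᵥ x)) * (star x ⬝ᵥ (A ^ i *ᵥ x)) := by
      have h1 : H ^ j * A ^ (i + 1) =
          H ^ (j + 1) * A ^ i + H ^ j * vecMulVec x (star x) * A ^ i := by
        rw [show vecMulVec x (star x) = A - H by rw [hA]; abel]
        rw [pow_succ' A, pow_succ H]
        noncomm_ring
      rw [h1, add_mulVec, dotProduct_add, mul_vecMulVec, vecMulVec_mul, vecMulVec_mulVec,
        dotProduct_smul, ← dotProduct_mulVec]
      simp
    simp only [hu, hc, hform, Complex.add_re, Complex.re_ofReal_mul, pow_zero, Matrix.mul_one,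
      Matrix.one_mul, Complex.ofReal_re]
  have hlower := pow_mul_le_of_mixed_moment_recursion hr hL hLr hrec
    (fun j => by
      rw [hu0]
      exact Finset.sum_nonneg fun i _ => mul_nonneg (pow_nonneg (hr.le.trans (hev i)) _) (hw x i))
    (fun k l => by
      rw [hu0, hu0, hu0]
      have h0 : ∀ i, 0 ≤ ev i := fun i => hr.le.trans (hev i)
      refine (sum_pow_mul_sum_pow_le h0 (hw x) k l).trans
        (mul_le_mul_of_nonneg_right (by rwa [← hnorm]) ?_)
      exact Finset.sum_nonneg fun i _ => mul_nonneg (pow_nonneg (h0 i) _) (hw x i))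
    (fun l => by
      rw [hu0, hu0, Finset.mul_sum]
      refine Finset.sum_le_sum fun i _ => ?_
      rw [pow_succ', mul_assoc]
      exact mul_le_mul_of_nonneg_right (hev i)
        (mul_nonneg (pow_nonneg (hr.le.trans (hev i)) _) (hw x i)))
  have htop : ∀ k, (star x ⬝ᵥ (A ^ (k + 1) *ᵥ x)).re / R ≤ u k 0 := by
    intro k
    simp only [hu, pow_zero, Matrix.one_mul]
    rw [div_le_iff₀ hR, hform', hform', Complex.ofReal_re, Complex.ofReal_re, Finset.sum_mul]
    refine Finset.sum_le_sum fun i _ => ?_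
    have := mul_le_mul_of_nonneg_right (hev'R i) (mul_nonneg (pow_nonneg (hev'0 i) k) (hw' x i))
    rw [pow_succ]
    linarith
  rw [Complex.sub_re, Complex.re_sum] at htel
  have hsum : (∑ j ∈ Finset.range q, (1 - L / r) ^ j) / R * (star x ⬝ᵥ (A ^ q *ᵥ x)).re ≤
      ∑ i ∈ Finset.range q, (star x ⬝ᵥ ((H ^ (q - 1 - i) * A ^ i) *ᵥ x)).re := by
    rw [← Finset.sum_range_reflect (fun j => (1 - L / r) ^ j), Finset.sum_div, Finset.sum_mul]
    refine Finset.sum_le_sum fun i hi => ?_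
    have hi' : i < q := Finset.mem_range.1 hi
    have h1 := hlower i (q - 1 - i)
    have h2 := htop (q - 1)
    rw [show q - 1 + 1 = q by omega] at h2
    rw [show i + (q - 1 - i) = q - 1 by omega] at h1
    have hfac : 0 ≤ (1 - L / r) ^ (q - 1 - i) :=
      pow_nonneg (sub_nonneg.2 ((div_le_one hr).2 hLr)) _
    calc (1 - L / r) ^ (q - 1 - i) / R * (star x ⬝ᵥ (A ^ q *ᵥ x)).re
        = (1 - L / r) ^ (q - 1 - i) * ((star x ⬝ᵥ (A ^ q *ᵥ x)).re / R) := by ring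
      _ ≤ _ := (mul_le_mul_of_nonneg_left h2 hfac).trans h1
  linarith

theorem Matrix.IsHermitian.eigenvalue_weights_nonneg {A : Matrix ι ι ℂ} (hA : A.IsHermitian)
    (hpos : ∀ v, 0 ≤ (star v ⬝ᵥ (A *ᵥ v)).re) :
    ∃ (ev : ι → ℝ) (w : (ι → ℂ) → ι → ℝ), (∀ i, 0 ≤ ev i) ∧ (∀ x i, 0 ≤ w x i) ∧
      (∀ x, (star x ⬝ᵥ x).re = ∑ i, w x i) ∧
      (∀ x, (star x ⬝ᵥ (A *ᵥ x)).re = ∑ i, ev i * w x i) ∧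
      (∀ l, (A ^ l).trace.re = ∑ i, ev i ^ l) := by
  obtain ⟨ev, w, hw, hform, htr, hex⟩ := hA.exists_spectral_weights
  have hone : ∀ x, (star x ⬝ᵥ (A *ᵥ x)).re = ∑ i, ev i * w x i := by
    intro x
    have := congrArg Complex.re (hform x 1)
    simpa only [pow_one, Complex.ofReal_re] using this
  refine ⟨ev, w, fun i => ?_, hw, fun x => ?_, hone, fun l => ?_⟩
  · obtain ⟨v, hv⟩ := hex i
    have h := hpos v
    rw [hone, hv] at h
    simpa [Pi.single_apply] using h
  · have := congrArg Complex.re (hform x 0)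
    simpa only [pow_zero, one_mul, one_mulVec, Complex.ofReal_re] using this
  · rw [htr, Complex.ofReal_re]

theorem Matrix.IsHermitian.re_trace_pow_nonneg {A : Matrix ι ι ℂ} (hA : A.IsHermitian)
    (hpos : ∀ v, 0 ≤ (star v ⬝ᵥ (A *ᵥ v)).re) (q : ℕ) : 0 ≤ (A ^ q).trace.re := by
  obtain ⟨ev, w, hev, -, -, -, htr⟩ := hA.eigenvalue_weights_nonneg hpos
  rw [htr]
  exact Finset.sum_nonneg fun i _ => pow_nonneg (hev i) q

/-- A strict Rayleigh quotient bound gives a lower bound for the trace of a power. -/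
theorem Matrix.IsHermitian.pow_le_re_trace_pow {A : Matrix ι ι ℂ} (hA : A.IsHermitian)
    (hpos : ∀ v, 0 ≤ (star v ⬝ᵥ (A *ᵥ v)).re) {b : ℝ} (hb : 0 ≤ b) {v : ι → ℂ}
    (hv : b * (star v ⬝ᵥ v).re < (star v ⬝ᵥ (A *ᵥ v)).re) (q : ℕ) :
    b ^ q ≤ (A ^ q).trace.re := by
  obtain ⟨ev, w, hev, hw, hnorm, hone, htr⟩ := hA.eigenvalue_weights_nonneg hpos
  rw [hnorm, hone, Finset.mul_sum] at hv
  obtain ⟨i, -, hi⟩ := Finset.exists_lt_of_sum_lt hv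
  have hbi : b < ev i := lt_of_mul_lt_mul_right hi (hw v i)
  rw [htr]
  exact (pow_le_pow_left₀ hb hbi.le q).trans
    (Finset.single_le_sum (f := fun i => ev i ^ q) (fun i _ => pow_nonneg (hev i) q)
      (Finset.mem_univ i))

section Sampling

variable {κ : Type*} [Fintype κ] {x : κ → ι → ℂ} {ρ : κ → ℝ} {L : ℝ}

/-- One sampling step contracts the expected trace of a power. -/
theorem sum_mul_re_trace_sub_rank_one_pow_le (hρ : ∀ i, 0 ≤ ρ i) (hρ1 : ∑ i, ρ i = 1)
    (hiso : ∑ i, (ρ i : ℂ) • vecMulVec (x i) (star (x i)) = 1)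
    (hL : 0 ≤ L) (hx : ∀ i, (star (x i) ⬝ᵥ x i).re ≤ L) {r R : ℝ} (hr : 0 < r) (hLr : L ≤ r)
    (hR : 0 < R) (q : ℕ) {A : Matrix ι ι ℂ} (hA : A.IsHermitian)
    (hlow : ∀ v, (r + L) * (star v ⬝ᵥ v).re ≤ (star v ⬝ᵥ (A *ᵥ v)).re)
    (hup : ∀ v, (star v ⬝ᵥ (A *ᵥ v)).re ≤ R * (star v ⬝ᵥ v).re) :
    ∑ i, ρ i * ((A - vecMulVec (x i) (star (x i))) ^ q).trace.re ≤
      Real.exp (-((∑ j ∈ Finset.range q, (1 - L / r) ^ j) / R)) * (A ^ q).trace.re := by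
  set K := (∑ j ∈ Finset.range q, (1 - L / r) ^ j) / R with hK
  have hnn : ∀ v : ι → ℂ, 0 ≤ (star v ⬝ᵥ v).re := fun v => by
    rw [re_star_dotProduct_self]; positivity
  have hstep : ∀ i, ((A - vecMulVec (x i) (star (x i))) ^ q).trace.re ≤
      (A ^ q).trace.re - K * (star (x i) ⬝ᵥ (A ^ q *ᵥ x i)).re := by
    intro i
    have hH : (A - vecMulVec (x i) (star (x i))).IsHermitian := by
      refine hA.sub ?_
      rw [IsHermitian, conjTranspose_vecMulVec, star_star]
    have h := trace_pow_le_of_rank_one hH hr hL hLr hR (hx i) (fun v => ?_)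
      (by simpa only [sub_add_cancel] using hup) q
    · simpa only [sub_add_cancel] using h
    · rw [sub_mulVec, dotProduct_sub, Complex.sub_re, re_star_dotProduct_vecMulVec_mulVec]
      have h1 := norm_star_dotProduct_sq_le (x i) v
      have h2 := mul_le_mul_of_nonneg_right (hx i) (hnn v)
      linarith [hlow v]
  have hexp : ∑ i, ρ i * (star (x i) ⬝ᵥ (A ^ q *ᵥ x i)).re = (A ^ q).trace.re := by
    have h : (A ^ q).trace = ∑ i, (ρ i : ℂ) * (star (x i) ⬝ᵥ (A ^ q *ᵥ x i)) := by
      conv_lhs => rw [← Matrix.mul_one (A ^ q), ← hiso, Finset.mul_sum, trace_sum]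
      refine Finset.sum_congr rfl fun i _ => ?_
      rw [Matrix.mul_smul, trace_smul, mul_vecMulVec, trace_vecMulVec, dotProduct_comm, smul_eq_mul]
    rw [h, Complex.re_sum]
    exact Finset.sum_congr rfl fun i _ => (Complex.re_ofReal_mul _ _).symm
  have hpos : 0 ≤ (A ^ q).trace.re := hA.re_trace_pow_nonneg (fun v =>
    (mul_nonneg (by positivity) (hnn v)).trans (hlow v)) q
  calc ∑ i, ρ i * ((A - vecMulVec (x i) (star (x i))) ^ q).trace.re
      ≤ ∑ i, ρ i * ((A ^ q).trace.re - K * (star (x i) ⬝ᵥ (A ^ q *ᵥ x i)).re) :=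
        Finset.sum_le_sum fun i _ => mul_le_mul_of_nonneg_left (hstep i) (hρ i)
    _ = (∑ i, ρ i) * (A ^ q).trace.re -
          K * ∑ i, ρ i * (star (x i) ⬝ᵥ (A ^ q *ᵥ x i)).re := by
        rw [Finset.sum_mul, Finset.mul_sum, ← Finset.sum_sub_distrib]
        exact Finset.sum_congr rfl fun i _ => by ring
    _ = (1 - K) * (A ^ q).trace.re := by rw [hρ1, hexp]; ring
    _ ≤ Real.exp (-K) * (A ^ q).trace.re :=
        mul_le_mul_of_nonneg_right (Real.one_sub_le_exp_neg K) hpos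

/-- Expected trace of a power after subtracting `k` independent rank-one samples. -/
theorem sum_prod_mul_re_trace_sub_sum_pow_le (hρ : ∀ i, 0 ≤ ρ i) (hρ1 : ∑ i, ρ i = 1)
    (hiso : ∑ i, (ρ i : ℂ) • vecMulVec (x i) (star (x i)) = 1)
    (hL : 0 ≤ L) (hx : ∀ i, (star (x i) ⬝ᵥ x i).re ≤ L) {r R : ℝ} (hr : 0 < r) (hLr : L ≤ r)
    (hR : 0 < R) (q k : ℕ) {A : Matrix ι ι ℂ} (hA : A.IsHermitian)
    (hlow : ∀ v, (r + k * L) * (star v ⬝ᵥ v).re ≤ (star v ⬝ᵥ (A *ᵥ v)).re)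
    (hup : ∀ v, (star v ⬝ᵥ (A *ᵥ v)).re ≤ R * (star v ⬝ᵥ v).re) :
    ∑ j : Fin k → κ, (∏ l, ρ (j l)) *
        ((A - ∑ l, vecMulVec (x (j l)) (star (x (j l)))) ^ q).trace.re ≤
      Real.exp (-((∑ j ∈ Finset.range q, (1 - L / r) ^ j) / R)) ^ k * (A ^ q).trace.re := by
  have hnn : ∀ v : ι → ℂ, 0 ≤ (star v ⬝ᵥ v).re := fun v => by
    rw [re_star_dotProduct_self]; positivity
  induction k generalizing A with
  | zero => simp
  | succ k ih =>
    rw [← (Fin.consEquiv fun _ : Fin (k + 1) => κ).sum_comp, Fintype.sum_prod_type]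
    set E := Real.exp (-((∑ j ∈ Finset.range q, (1 - L / r) ^ j) / R)) with hE
    have hE0 : 0 ≤ E := (Real.exp_pos _).le
    have hinner : ∀ i, ∑ j : Fin k → κ,
        (∏ l, ρ ((Fin.consEquiv fun _ : Fin (k + 1) => κ) (i, j) l)) *
          ((A - ∑ l, vecMulVec (x ((Fin.consEquiv fun _ : Fin (k + 1) => κ) (i, j) l))
            (star (x ((Fin.consEquiv fun _ : Fin (k + 1) => κ) (i, j) l)))) ^ q).trace.re ≤
        ρ i * (E ^ k * ((A - vecMulVec (x i) (star (x i))) ^ q).trace.re) := by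
      intro i
      have hH : (A - vecMulVec (x i) (star (x i))).IsHermitian := by
        refine hA.sub ?_
        rw [IsHermitian, conjTranspose_vecMulVec, star_star]
      have h := ih hH (fun v => ?_) (fun v => ?_)
      · refine le_trans (le_of_eq ?_) (mul_le_mul_of_nonneg_left h (hρ i))
        rw [Finset.mul_sum]
        refine Finset.sum_congr rfl fun j _ => ?_
        simp only [Fin.consEquiv_apply, Fin.prod_univ_succ, Fin.sum_univ_succ, Fin.cons_zero,
          Fin.cons_succ, sub_sub, mul_assoc]
      · rw [sub_mulVec, dotProduct_sub, Complex.sub_re, re_star_dotProduct_vecMulVec_mulVec]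
        have h1 := norm_star_dotProduct_sq_le (x i) v
        have h2 := mul_le_mul_of_nonneg_right (hx i) (hnn v)
        have h3 := hlow v
        push_cast at h3
        linarith
      · rw [sub_mulVec, dotProduct_sub, Complex.sub_re, re_star_dotProduct_vecMulVec_mulVec]
        have := hup v
        have := sq_nonneg ‖star (x i) ⬝ᵥ v‖
        linarith
    calc _ ≤ ∑ i, ρ i * (E ^ k * ((A - vecMulVec (x i) (star (x i))) ^ q).trace.re) :=
          Finset.sum_le_sum fun i _ => hinner i
      _ = E ^ k * ∑ i, ρ i * ((A - vecMulVec (x i) (star (x i))) ^ q).trace.re := by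
          rw [Finset.mul_sum]
          exact Finset.sum_congr rfl fun i _ => by ring
      _ ≤ E ^ k * (E * (A ^ q).trace.re) := by
          refine mul_le_mul_of_nonneg_left ?_ (pow_nonneg hE0 k)
          refine sum_mul_re_trace_sub_rank_one_pow_le hρ hρ1 hiso hL hx hr hLr hR q hA
            (fun v => le_trans (mul_le_mul_of_nonneg_right ?_ (hnn v)) (hlow v)) hup
          push_cast
          nlinarith [mul_nonneg (Nat.cast_nonneg (α := ℝ) k) hL]
      _ = E ^ (k + 1) * (A ^ q).trace.re := by ring

open Classical in
/-- Markov's inequality for the trace of a power of `R - ∑ x x*`. -/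
theorem sum_prod_exists_lt_mul_pow_le (hρ : ∀ i, 0 ≤ ρ i) (hρ1 : ∑ i, ρ i = 1)
    (hiso : ∑ i, (ρ i : ℂ) • vecMulVec (x i) (star (x i)) = 1)
    (hL : 0 ≤ L) (hx : ∀ i, (star (x i) ⬝ᵥ x i).re ≤ L) {r : ℝ} (hr : 0 < r) (hLr : L ≤ r)
    (q n : ℕ) {s : ℝ} (hs : s ≤ r + n * L) :
    (∑ j : Fin n → κ with ∃ v, ∑ l, ‖star (x (j l)) ⬝ᵥ v‖ ^ 2 < s * (star v ⬝ᵥ v).re,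
        ∏ l, ρ (j l)) * (r + n * L - s) ^ q ≤
      Real.exp (-((∑ j ∈ Finset.range q, (1 - L / r) ^ j) / (r + n * L))) ^ n *
        (Fintype.card ι * (r + n * L) ^ q) := by
  set R := r + n * L with hRdef
  have hR : 0 < R := by positivity
  have hnn : ∀ v : ι → ℂ, 0 ≤ (star v ⬝ᵥ v).re := fun v => by
    rw [re_star_dotProduct_self]; positivity
  have hscal : ∀ v : ι → ℂ,
      (star v ⬝ᵥ (((R : ℂ) • (1 : Matrix ι ι ℂ)) *ᵥ v)).re = R * (star v ⬝ᵥ v).re := by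
    intro v
    rw [smul_mulVec, one_mulVec, dotProduct_smul, smul_eq_mul, Complex.re_ofReal_mul]
  have hherm : ((R : ℂ) • (1 : Matrix ι ι ℂ)).IsHermitian := by
    rw [IsHermitian, conjTranspose_smul, conjTranspose_one]
    simp
  have hmain := sum_prod_mul_re_trace_sub_sum_pow_le hρ hρ1 hiso hL hx hr hLr hR q n hherm
    (fun v => (hscal v).ge) (fun v => (hscal v).le)
  have htr : (((R : ℂ) • (1 : Matrix ι ι ℂ)) ^ q).trace.re = Fintype.card ι * R ^ q := by
    rw [smul_pow, one_pow, trace_smul, trace_one, smul_eq_mul, ← Complex.ofReal_pow,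
      Complex.re_ofReal_mul, Complex.natCast_re, mul_comm]
  rw [htr] at hmain
  refine le_trans ?_ hmain
  have hform : ∀ (j : Fin n → κ) v, (star v ⬝ᵥ (((R : ℂ) • (1 : Matrix ι ι ℂ) -
      ∑ l, vecMulVec (x (j l)) (star (x (j l)))) *ᵥ v)).re =
        R * (star v ⬝ᵥ v).re - ∑ l, ‖star (x (j l)) ⬝ᵥ v‖ ^ 2 := by
    intro j v
    rw [sub_mulVec, dotProduct_sub, Complex.sub_re, hscal, sum_mulVec, dotProduct_sum,
      Complex.re_sum]
    simp only [re_star_dotProduct_vecMulVec_mulVec]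
  have hpos : ∀ (j : Fin n → κ) v, 0 ≤ (star v ⬝ᵥ (((R : ℂ) • (1 : Matrix ι ι ℂ) -
      ∑ l, vecMulVec (x (j l)) (star (x (j l)))) *ᵥ v)).re := by
    intro j v
    rw [hform]
    have h1 : ∑ l, ‖star (x (j l)) ⬝ᵥ v‖ ^ 2 ≤ ∑ _l : Fin n, L * (star v ⬝ᵥ v).re :=
      Finset.sum_le_sum fun l _ => (norm_star_dotProduct_sq_le _ v).trans
        (mul_le_mul_of_nonneg_right (hx _) (hnn v))
    rw [Finset.sum_const, Finset.card_univ, Fintype.card_fin, nsmul_eq_mul] at h1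
    have h2 := mul_nonneg hr.le (hnn v)
    rw [hRdef]
    linarith
  have hH : ∀ j : Fin n → κ, ((R : ℂ) • (1 : Matrix ι ι ℂ) -
      ∑ l, vecMulVec (x (j l)) (star (x (j l)))).IsHermitian := by
    intro j
    refine hherm.sub ?_
    rw [IsHermitian, conjTranspose_sum]
    exact Finset.sum_congr rfl fun l _ => by rw [conjTranspose_vecMulVec, star_star]
  rw [Finset.sum_mul]
  refine (Finset.sum_le_sum fun j hj => ?_).trans
    (Finset.sum_le_sum_of_subset_of_nonneg (Finset.filter_subset _ _) fun j _ _ =>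
      mul_nonneg (Finset.prod_nonneg fun l _ => hρ _) ((hH j).re_trace_pow_nonneg (hpos j) q))
  obtain ⟨v, hv⟩ := (Finset.mem_filter.1 hj).2
  refine mul_le_mul_of_nonneg_left ?_ (Finset.prod_nonneg fun l _ => hρ _)
  refine (hH j).pow_le_re_trace_pow (hpos j) (sub_nonneg.2 hs) (v := v) ?_ q
  rw [hform]
  linarith

end Sampling

end

theorem sq_div_three_lt_chernoff_exponent {t : ℝ} (ht : 0 < t) :
    t ^ 2 / 3 < 1 - Real.exp (-t) - t * (1 - t) := by
  have h1 := Real.quadratic_le_exp_of_nonneg ht.le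
  have h2 : Real.exp (-t) ≤ 1 / (1 + t + t ^ 2 / 2) := by
    rw [Real.exp_neg, ← one_div]
    exact one_div_le_one_div_of_le (by positivity) h1
  have h3 : 1 / (1 + t + t ^ 2 / 2) < 1 - t + 2 * t ^ 2 / 3 := by
    rw [div_lt_iff₀ (by positivity)]
    have : 0 < t ^ 2 := by positivity
    have : 0 < t ^ 3 := by positivity
    have : 0 < t ^ 4 := by positivity
    nlinarith
  linarith

/-- Choice of the exponent and of the shift in the trace-power method. -/
theorem exists_trace_power_parameters {L t p d : ℝ} {n : ℕ} (hL : 0 < L) (ht : 0 < t) (ht1 : t < 1)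
    (hp : 0 < p) (hd : 0 < d) (hn : 0 < n) (hlog : Real.log (d / p) ≤ n / L * (t ^ 2 / 3)) :
    ∃ (q : ℕ) (r : ℝ), 0 < r ∧ L ≤ r ∧ (1 - t) * n < r + n * L ∧
      Real.exp (-((∑ j ∈ Finset.range q, (1 - L / r) ^ j) / (r + n * L))) ^ n *
        (d * (r + n * L) ^ q) < p * (r + n * L - (1 - t) * n) ^ q := by
  have hn' : (0 : ℝ) < n := Nat.cast_pos.2 hn
  set a : ℝ := -((1 - t) * n * t / L) with ha
  have hlim1 : Filter.Tendsto (fun q : ℕ => d * Real.exp (-(n / L * ((1 - n * t / (q : ℝ)) *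
      (1 - Real.exp (-t)))))) Filter.atTop
      (nhds (d * Real.exp (-(n / L * ((1 - 0) * (1 - Real.exp (-t))))))) := by
    have h0 : Filter.Tendsto (fun q : ℕ => n * t / (q : ℝ)) Filter.atTop (nhds 0) :=
      tendsto_const_div_atTop_nhds_zero_nat _
    exact ((Real.continuous_exp.tendsto _).comp
      (((h0.const_sub 1).mul_const _).const_mul _).neg).const_mul d
  have hlim2 : Filter.Tendsto (fun q : ℕ => p * (1 + a / (q : ℝ)) ^ q) Filter.atTop
      (nhds (p * Real.exp a)) :=
    (Real.tendsto_one_add_div_pow_exp a).const_mul p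
  have hlt : d * Real.exp (-(n / L * ((1 - 0) * (1 - Real.exp (-t))))) < p * Real.exp a := by
    have h1 := mul_lt_mul_of_pos_left (sq_div_three_lt_chernoff_exponent ht) (div_pos hn' hL)
    have h2 : d = p * Real.exp (Real.log (d / p)) := by
      rw [Real.exp_log (div_pos hd hp)]
      field_simp
    rw [h2, mul_assoc, ← Real.exp_add]
    refine mul_lt_mul_of_pos_left (Real.exp_lt_exp.2 ?_) hp
    have h3 : a = -(n / L * (t * (1 - t))) := by rw [ha]; ring
    rw [h3]
    linarith
  have hbig : ∀ᶠ q : ℕ in Filter.atTop, (n + 1 + n / L : ℝ) < q :=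
    tendsto_natCast_atTop_atTop.eventually_gt_atTop _
  obtain ⟨q, hq, hqbig⟩ := ((hlim1.eventually_lt hlim2 hlt).and hbig).exists
  have hnL : 0 < n / L := div_pos hn' hL
  have hq0 : (0 : ℝ) < q := by linarith
  have hqL : L / t * q = L / t * q - n * L + n * L := by ring
  have hLt : L ≤ L / t := by rw [le_div_iff₀ ht]; nlinarith
  have hLr : L ≤ L / t * q - n * L := by
    have h1 : L * (n + 1) ≤ L / t * q :=
      mul_le_mul hLt (by linarith) (by positivity) (by positivity)
    linarith
  refine ⟨q, L / t * q - n * L, by linarith, hLr, ?_, ?_⟩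
  · rw [← hqL]
    have h1 : L * (n / L) < L / t * q :=
      mul_lt_mul' hLt (by linarith) (by positivity) (by positivity)
    have h2 : L * (n / L) = n := by field_simp
    nlinarith
  · rw [← hqL]
    set r := L / t * q - n * L with hr
    set R := L / t * q with hR
    have hr0 : 0 < r := by linarith
    have hR0 : 0 < R := by positivity
    have hgeom : (∑ j ∈ Finset.range q, (1 - L / r) ^ j) = r / L * (1 - (1 - L / r) ^ q) := by
      have h := geom_sum_mul (1 - L / r) q
      have h1 : (∑ j ∈ Finset.range q, (1 - L / r) ^ j) * (L / r) = 1 - (1 - L / r) ^ q := by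
        linarith
      rw [← h1]
      field_simp
    have hpow : (1 - L / r) ^ q ≤ Real.exp (-t) := by
      calc (1 - L / r) ^ q ≤ Real.exp (-(L / r)) ^ q :=
            pow_le_pow_left₀ (sub_nonneg.2 ((div_le_one hr0).2 hLr)) (Real.one_sub_le_exp_neg _) q
        _ = Real.exp (-(q * (L / r))) := by rw [← Real.exp_nat_mul]; ring_nf
        _ ≤ Real.exp (-t) := by
            refine Real.exp_le_exp.2 (neg_le_neg ?_)
            rw [← mul_div_assoc, le_div_iff₀ hr0, hr, hR]
            have h1 : t * (L / t * q - n * L) = q * L - t * (n * L) := by field_simp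
            rw [h1]
            have : 0 ≤ t * (n * L) := by positivity
            linarith
    have hK : 1 / L * ((1 - n * t / q) * (1 - Real.exp (-t))) ≤
        (∑ j ∈ Finset.range q, (1 - L / r) ^ j) / R := by
      have h1 : 1 - n * t / q = r / R := by rw [hr, hR]; field_simp
      rw [hgeom, h1]
      have h2 : r / R * (1 - Real.exp (-t)) ≤ r / R * (1 - (1 - L / r) ^ q) :=
        mul_le_mul_of_nonneg_left (by linarith) (by positivity)
      calc 1 / L * (r / R * (1 - Real.exp (-t))) ≤ 1 / L * (r / R * (1 - (1 - L / r) ^ q)) :=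
            mul_le_mul_of_nonneg_left h2 (by positivity)
        _ = _ := by ring
    have hexp : Real.exp (-((∑ j ∈ Finset.range q, (1 - L / r) ^ j) / R)) ^ n ≤
        Real.exp (-(n / L * ((1 - n * t / (q : ℝ)) * (1 - Real.exp (-t))))) := by
      rw [← Real.exp_nat_mul]
      refine Real.exp_le_exp.2 ?_
      have := mul_le_mul_of_nonneg_left hK hn'.le
      have h2 : (n : ℝ) / L * ((1 - n * t / (q : ℝ)) * (1 - Real.exp (-t))) =
        n * (1 / L * ((1 - n * t / q) * (1 - Real.exp (-t)))) := by ring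
      rw [h2]
      linarith
    have hw : R - (1 - t) * n = R * (1 + a / q) := by
      rw [ha, hR]; field_simp; ring
    rw [hw, mul_pow R (1 + a / q)]
    calc _ ≤ Real.exp (-(n / L * ((1 - n * t / (q : ℝ)) * (1 - Real.exp (-t))))) * (d * R ^ q) :=
          mul_le_mul_of_nonneg_right hexp (by positivity)
      _ = d * Real.exp (-(n / L * ((1 - n * t / (q : ℝ)) * (1 - Real.exp (-t))))) * R ^ q := by
          ring
      _ < p * (1 + a / q) ^ q * R ^ q := mul_lt_mul_of_pos_right hq (by positivity)
      _ = _ := by ring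

open Classical in
/-- Lower tail matrix Chernoff bound for independent rank-one samples in isotropic position. -/
theorem sum_prod_exists_lt_lt_of_log_le {ι κ : Type*} [Fintype ι] [DecidableEq ι] [Nonempty ι]
    [Fintype κ]
    {x : κ → ι → ℂ} {ρ : κ → ℝ} {L t p : ℝ} {n : ℕ} (hρ : ∀ i, 0 ≤ ρ i) (hρ1 : ∑ i, ρ i = 1)
    (hiso : ∑ i, (ρ i : ℂ) • vecMulVec (x i) (star (x i)) = 1) (hL : 0 < L)
    (hx : ∀ i, (star (x i) ⬝ᵥ x i).re ≤ L) (ht : 0 < t) (ht1 : t < 1) (hp : 0 < p) (hn : 0 < n)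
    (hlog : Real.log (Fintype.card ι / p) ≤ n / L * (t ^ 2 / 3)) :
    ∑ j : Fin n → κ with
        ∃ v, ∑ l, ‖star (x (j l)) ⬝ᵥ v‖ ^ 2 < (1 - t) * n * (star v ⬝ᵥ v).re,
      ∏ l, ρ (j l) < p := by
  obtain ⟨q, r, hr, hLr, hs, hlt⟩ := exists_trace_power_parameters hL ht ht1 hp
    (Nat.cast_pos.2 Fintype.card_pos) hn hlog
  have h := sum_prod_exists_lt_mul_pow_le hρ hρ1 hiso hL.le hx hr hLr q n hs.le
  exact lt_of_mul_lt_mul_right (h.trans_lt hlt) (pow_nonneg (sub_nonneg.2 hs.le) q)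

open Classical in
theorem measureReal_pi_eq_sum_prod {κ : Type*} [Fintype κ] [MeasurableSpace κ]
    [MeasurableSingletonClass κ] (μ : Measure κ) [IsProbabilityMeasure μ] {n : ℕ}
    (P : (Fin n → κ) → Prop) :
    (Measure.pi fun _ : Fin n => μ).real {j | P j} =
      ∑ j : Fin n → κ with P j, ∏ l, μ.real {j l} := by
  have h := sum_measureReal_singleton (μ := Measure.pi fun _ : Fin n => μ)
    (Finset.univ.filter P)
  rw [Finset.coe_filter] at h
  simp only [Finset.mem_univ, true_and] at h
  rw [← h]
  refine Finset.sum_congr rfl fun j _ => ?_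
  rw [measureReal_def, Measure.pi_singleton, ENNReal.toReal_prod]
  rfl

/-- Unweighted random subsampling preserving the lower frame bound
(Theorem `theorem:unweighted_randomy`). -/
theorem stmt_10 (m M : ℕ) (hMm : m ≤ M) (y : Fin M → Fin m → ℂ) (A B : ℝ)
    (hA : 0 < A) (hAB : A ≤ B)
    (hframe : ∀ x : Fin m → ℂ,
      A * ∑ j, ‖x j‖ ^ 2 ≤ ∑ i, ‖star (y i) ⬝ᵥ x‖ ^ 2 ∧
      ∑ i, ‖star (y i) ⬝ᵥ x‖ ^ 2 ≤ B * ∑ j, ‖x j‖ ^ 2)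
    (Yt : Matrix (Fin M) (Fin m) ℂ)
    (hortho : Ytᴴ * Yt = 1)
    (hrange : LinearMap.range (Matrix.mulVecLin (Matrix.of fun i j => star (y i j))) ≤
      LinearMap.range Yt.mulVecLin)
    (c p t : ℝ) (hc : 0 < c) (hc1 : c < 1) (hp : 0 < p) (hp1 : p < 1)
    (ht : 0 < t) (ht1 : t < 1)
    (n : ℕ) (hn : 3 / (c * t ^ 2) * m * Real.log (m / p) ≤ (n : ℝ))
    (ρ : Fin M → ℝ)
    (hρ : ∀ i, ρ i = (1 - c) / M + c * (∑ j, ‖Yt i j‖ ^ 2) / m)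
    (μ : Measure (Fin M)) [IsProbabilityMeasure μ]
    (hμ : ∀ i, μ {i} = ENNReal.ofReal (ρ i)) :
    ENNReal.ofReal (1 - p) <
      Measure.pi (fun _ : Fin n => μ)
        {j : Fin n → Fin M | ∀ a : Fin m → ℂ,
          (1 / M) * ∑ i, ‖star (y i) ⬝ᵥ a‖ ^ 2 ≤
            1 / ((1 - c) * (1 - t)) *
              ((1 / n) * ∑ k, ‖star (y (j k)) ⬝ᵥ a‖ ^ 2)} := by
  have hM : 0 < M := by
    rcases Nat.eq_zero_or_pos M with rfl | h
    · have h1 := measure_univ (μ := μ)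
      simp [Set.eq_empty_of_isEmpty] at h1
    · exact h
  have hM' : (0 : ℝ) < M := Nat.cast_pos.2 hM
  rcases Nat.eq_zero_or_pos m with rfl | hm
  · simp [ENNReal.ofReal_lt_one, hp]
  have hm' : (0 : ℝ) < m := Nat.cast_pos.2 hm
  have : Nonempty (Fin m) := ⟨⟨0, hm⟩⟩
  have hc1' : 0 < 1 - c := sub_pos.2 hc1
  have ht1' : 0 < 1 - t := sub_pos.2 ht1
  have hρlow : ∀ i, (1 - c) / M ≤ ρ i := fun i => by
    rw [hρ]
    exact le_add_of_nonneg_right (by positivity)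
  have hρpos : ∀ i, 0 < ρ i := fun i => (div_pos hc1' hM').trans_le (hρlow i)
  have hμρ : ∀ i, μ.real {i} = ρ i := fun i => by
    rw [measureReal_def, hμ, ENNReal.toReal_ofReal (hρpos i).le]
  have hρ1 : ∑ i, ρ i = 1 := by
    have h := sum_measureReal_singleton (μ := μ) Finset.univ
    simpa [hμρ] using h
  have hn0 : 0 < n := by
    have h1 : 1 < m / p := by
      rw [lt_div_iff₀ hp, one_mul]
      exact hp1.trans_le (by exact_mod_cast hm)
    have h2 : 0 < 3 / (c * t ^ 2) * m * Real.log (m / p) :=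
      mul_pos (by positivity) (Real.log_pos h1)
    exact_mod_cast h2.trans_le hn
  have hn0' : (0 : ℝ) < n := Nat.cast_pos.2 hn0
  set x : Fin M → Fin m → ℂ := fun i l => star (Yt i l) / (√(ρ i) : ℂ) with hxdef
  have hsqrt : ∀ i, ((√(ρ i) : ℝ) : ℂ) * (√(ρ i) : ℝ) = (ρ i : ℂ) := fun i => by
    rw [← Complex.ofReal_mul, Real.mul_self_sqrt (hρpos i).le]
  have hxnorm : ∀ i, (star (x i) ⬝ᵥ x i).re ≤ m / c := by
    intro i
    have h1 : (star (x i) ⬝ᵥ x i).re = (∑ j, ‖Yt i j‖ ^ 2) / ρ i := by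
      rw [re_star_dotProduct_self, Finset.sum_div]
      refine Finset.sum_congr rfl fun j _ => ?_
      simp only [hxdef, norm_div, norm_star, div_pow, Complex.norm_real, Real.norm_eq_abs, sq_abs,
        Real.sq_sqrt (hρpos i).le]
    rw [h1, div_le_div_iff₀ (hρpos i) hc, hρ]
    have h2 : (m : ℝ) * ((1 - c) / M + c * (∑ j, ‖Yt i j‖ ^ 2) / m) =
        m * ((1 - c) / M) + (∑ j, ‖Yt i j‖ ^ 2) * c := by
      field_simp
    rw [h2]
    exact le_add_of_nonneg_left (by positivity)
  have hiso : ∑ i, (ρ i : ℂ) • vecMulVec (x i) (star (x i)) = 1 := by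
    rw [← hortho]
    ext a b
    rw [Matrix.sum_apply, Matrix.mul_apply]
    refine Finset.sum_congr rfl fun i _ => ?_
    have hne : ((√(ρ i) : ℝ) : ℂ) ≠ 0 :=
      Complex.ofReal_ne_zero.2 (Real.sqrt_pos.2 (hρpos i)).ne'
    simp only [hxdef, Matrix.smul_apply, vecMulVec_apply, Pi.star_apply, smul_eq_mul, star_div₀,
      Complex.conj_conj, conjTranspose_apply, RCLike.star_def, Complex.conj_ofReal, ← hsqrt i]
    field_simp
  have hxv : ∀ i v, ‖star (x i) ⬝ᵥ v‖ ^ 2 = ‖(Yt *ᵥ v) i‖ ^ 2 / ρ i := by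
    intro i v
    have h1 : star (x i) ⬝ᵥ v = (Yt *ᵥ v) i / (√(ρ i) : ℂ) := by
      simp only [mulVec, dotProduct, hxdef, Pi.star_apply, star_div₀, RCLike.star_def,
        Complex.conj_ofReal, Finset.sum_div]
      exact Finset.sum_congr rfl fun l _ => by simp; ring
    rw [h1, norm_div, div_pow, Complex.norm_real, Real.norm_eq_abs, sq_abs,
      Real.sq_sqrt (hρpos i).le]
  have hlog : Real.log (Fintype.card (Fin m) / p) ≤ n / (m / c) * (t ^ 2 / 3) := by
    rw [Fintype.card_fin]
    have h1 := mul_le_mul_of_nonneg_left hn (show 0 ≤ c * t ^ 2 / (3 * m) by positivity)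
    have h2 : c * t ^ 2 / (3 * m) * (3 / (c * t ^ 2) * m * Real.log (m / p)) =
        Real.log (m / p) := by
      field_simp
    have h3 : c * t ^ 2 / (3 * m) * n = n / (m / c) * (t ^ 2 / 3) := by field_simp
    rwa [h2, h3] at h1
  have htail := sum_prod_exists_lt_lt_of_log_le (fun i => (hρpos i).le) hρ1 hiso
    (div_pos hm' hc) hxnorm ht ht1 hp hn0 hlog
  simp only [← hμρ] at htail
  rw [← measureReal_pi_eq_sum_prod] at htail
  rw [ENNReal.ofReal_lt_iff_lt_toReal (sub_nonneg.2 hp1.le) (measure_ne_top _ _)]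
  have hcompl := probReal_compl_eq_one_sub (μ := Measure.pi fun _ : Fin n => μ)
    (Set.toFinite {j : Fin n → Fin M |
      ∃ v, ∑ l, ‖star (x (j l)) ⬝ᵥ v‖ ^ 2 < (1 - t) * n * (star v ⬝ᵥ v).re}).measurableSet
  refine lt_of_lt_of_le (show 1 - p < _ by rw [← sub_lt_sub_iff_left 1] at htail; exact htail)
    (hcompl.symm.le.trans (measureReal_mono fun j hj a => ?_))
  simp only [Set.mem_compl_iff, Set.mem_ofPred_eq, not_exists, not_lt] at hj
  obtain ⟨b, hb⟩ := hrange ⟨a, rfl⟩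
  have hyb : ∀ i, star (y i) ⬝ᵥ a = (Yt *ᵥ b) i := fun i => (congrFun hb i).symm
  simp only [hyb]
  have hiso_b : ∑ i, ‖(Yt *ᵥ b) i‖ ^ 2 = (star b ⬝ᵥ b).re := by
    rw [← re_star_dotProduct_self, star_mulVec, ← dotProduct_mulVec, mulVec_mulVec, hortho,
      one_mulVec]
  rw [hiso_b]
  have hsum : ∑ l, ‖star (x (j l)) ⬝ᵥ b‖ ^ 2 ≤ M / (1 - c) * ∑ l, ‖(Yt *ᵥ b) (j l)‖ ^ 2 := by
    rw [Finset.mul_sum]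
    refine Finset.sum_le_sum fun l _ => ?_
    rw [hxv, div_mul_eq_mul_div, div_le_div_iff₀ (hρpos _) hc1']
    have h1 : 1 - c ≤ M * ρ (j l) := by
      have := hρlow (j l)
      rwa [div_le_iff₀' hM'] at this
    nlinarith [mul_le_mul_of_nonneg_left h1 (sq_nonneg ‖(Yt *ᵥ b) (j l)‖)]
  have hfinal := (hj b).trans hsum
  calc 1 / (M : ℝ) * (star b ⬝ᵥ b).re
      = 1 / (M * ((1 - t) * n)) * ((1 - t) * n * (star b ⬝ᵥ b).re) := by field_simp
    _ ≤ 1 / (M * ((1 - t) * n)) * (M / (1 - c) * ∑ l, ‖(Yt *ᵥ b) (j l)‖ ^ 2) :=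
        mul_le_mul_of_nonneg_left hfinal (by positivity)
    _ = 1 / ((1 - c) * (1 - t)) * (1 / n * ∑ l, ‖(Yt *ᵥ b) (j l)‖ ^ 2) := by
        field_simp
end

section
/- Let $(y^i)_{i=1}^M \subset \mathbb{C}^m$ be a Bessel sequence with bound $B > 0$, i.e., $\sum_{i=1}^M |\langle x, y^i \rangle|^2 \le B \|x\|_2^2$ for all $x \in \mathbb{C}^m$. Assume $M \ge m$ and that $\|y^i\|_2^2 \ge \beta m / M$ for some $\beta > 0$ and all $i$. Then for any $b > 1$ there exists a subset $J \subseteq \{1, \dots, M\}$ with $|J| \le \lceil bm \rceil$ such that for all $a \in \mathbb{C}^m$: $\frac{1}{M} \sum_{i=1}^M |\langle a, y^i \rangle|^2 \le \frac{B}{\beta} \cdot \frac{(\sqrt{b}+1)^2}{(\sqrt{b}-1)^2} \cdot \frac{1}{m} \sum_{i \in J} |\langle a, y^i \rangle|^2$. -/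
open Matrix

namespace BarrierMethod

open scoped ComplexOrder

variable {ι n : Type*} [Fintype n]

/-- `X` is positive definite and the trace of its inverse is at most `ε`. -/
def PotentialLE [DecidableEq n] (X : Matrix n n ℂ) (ε : ℝ) : Prop :=
  X.PosDef ∧ (trace X⁻¹).re ≤ ε

theorem potentialLE_unitary_conj [DecidableEq n] (U : unitary (Matrix n n ℂ))
    (X : Matrix n n ℂ) (ε : ℝ) :
    PotentialLE ((U : Matrix n n ℂ) * X * star (U : Matrix n n ℂ)) ε ↔ PotentialLE X ε := by
  have h1 : (U : Matrix n n ℂ) * star (U : Matrix n n ℂ) = 1 := Unitary.mul_star_self_of_mem U.2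
  have h2 : star (U : Matrix n n ℂ) * (U : Matrix n n ℂ) = 1 := Unitary.star_mul_self_of_mem U.2
  have hU : IsUnit (U : Matrix n n ℂ) := ⟨⟨U, star U, h1, h2⟩, rfl⟩
  unfold PotentialLE
  rw [Matrix.IsUnit.posDef_star_right_conjugate_iff hU]
  have hinv : (U : Matrix n n ℂ)⁻¹ = star (U : Matrix n n ℂ) := Matrix.inv_eq_right_inv h1
  have hinv' : (star (U : Matrix n n ℂ))⁻¹ = (U : Matrix n n ℂ) := Matrix.inv_eq_right_inv h2
  rw [Matrix.mul_inv_rev, Matrix.mul_inv_rev, hinv, hinv', Matrix.trace_mul_comm,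
    Matrix.mul_assoc, h2, Matrix.mul_one]

theorem potentialLE_diagonal_iff [DecidableEq n] (d : n → ℝ) (ε : ℝ) :
    PotentialLE (diagonal fun j => (d j : ℂ)) ε ↔ (∀ j, 0 < d j) ∧ ∑ j, (d j)⁻¹ ≤ ε := by
  unfold PotentialLE
  rw [Matrix.posDef_diagonal_iff]
  simp only [Complex.zero_lt_real]
  refine and_congr_right fun hd => ?_
  have h : (diagonal fun j => (d j : ℂ))⁻¹ = diagonal fun j => (((d j)⁻¹ : ℝ) : ℂ) := by
    apply Matrix.inv_eq_right_inv
    rw [diagonal_mul_diagonal, ← diagonal_one]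
    congr 1
    funext j
    rw [← Complex.ofReal_mul, mul_inv_cancel₀ (hd j).ne', Complex.ofReal_one]
  rw [h, trace_diagonal, Complex.re_sum]
  simp

theorem star_dotProduct_vecMulVec_mulVec (v x : n → ℂ) :
    star x ⬝ᵥ (vecMulVec v (star v) *ᵥ x) = ((‖star v ⬝ᵥ x‖ ^ 2 : ℝ) : ℂ) := by
  rw [vecMulVec_mulVec, op_smul_eq_smul, dotProduct_smul, smul_eq_mul]
  have : star x ⬝ᵥ v = star (star v ⬝ᵥ x) := by
    rw [star_dotProduct, dotProduct_comm]
  rw [this, Complex.star_def, Complex.mul_conj, Complex.normSq_eq_norm_sq]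

theorem star_dotProduct_diagonal_mulVec [DecidableEq n] (d : n → ℝ) (x : n → ℂ) :
    star x ⬝ᵥ ((diagonal fun j => (d j : ℂ)) *ᵥ x) = ((∑ j, d j * ‖x j‖ ^ 2 : ℝ) : ℂ) := by
  simp only [dotProduct, mulVec_diagonal, Complex.ofReal_sum]
  refine Finset.sum_congr rfl fun j _ => ?_
  rw [Complex.ofReal_mul, ← Complex.normSq_eq_norm_sq, ← Complex.mul_conj]
  simp
  ring

theorem norm_dotProduct_sq_le (d : n → ℝ) (hd : ∀ j, 0 < d j) (v x : n → ℂ) :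
    ‖star v ⬝ᵥ x‖ ^ 2 ≤ (∑ j, d j * ‖x j‖ ^ 2) * ∑ j, ‖v j‖ ^ 2 / d j := by
  have h1 : ‖star v ⬝ᵥ x‖ ≤ ∑ j, ‖v j‖ * ‖x j‖ := by
    refine (norm_sum_le _ _).trans_eq ?_
    simp
  refine (pow_le_pow_left₀ (norm_nonneg _) h1 2).trans ?_
  refine Finset.sum_sq_le_sum_mul_sum_of_sq_le_mul _ (fun j _ => ?_) (fun j _ => ?_)
    fun j _ => le_of_eq ?_
  · have := (hd j).le
    positivity
  · have := (hd j).le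
    positivity
  · have := (hd j).ne'
    field_simp

theorem inv_diagonal_add_smul_vecMulVec [DecidableEq n] (d : n → ℝ) (hd : ∀ j, 0 < d j)
    (v : n → ℂ) (t : ℝ)
    (ht : 0 < 1 + t * ∑ j, ‖v j‖ ^ 2 / d j) :
    ((diagonal fun j => (d j : ℂ)) + (t : ℂ) • vecMulVec v (star v))⁻¹ =
      (diagonal fun j => (d j : ℂ)⁻¹) - ((t / (1 + t * ∑ j, ‖v j‖ ^ 2 / d j) : ℝ) : ℂ) •
        vecMulVec (fun j => v j / d j) (star fun j => v j / d j) := by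
  set q := ∑ j, ‖v j‖ ^ 2 / d j with hq
  have hd' : ∀ j, (d j : ℂ) ≠ 0 := fun j => by exact_mod_cast (hd j).ne'
  apply Matrix.inv_eq_right_inv
  have e1 : (diagonal fun j => (d j : ℂ)) * (diagonal fun j => (d j : ℂ)⁻¹) = 1 := by
    rw [diagonal_mul_diagonal, ← diagonal_one]
    congr 1
    funext j
    exact mul_inv_cancel₀ (hd' j)
  have e2 : (diagonal fun j => (d j : ℂ)) *ᵥ (fun j => v j / d j) = v := by
    funext j
    rw [mulVec_diagonal]
    have := hd' j
    field_simp
  have e3 : star v ᵥ* (diagonal fun j => (d j : ℂ)⁻¹) = star fun j => v j / d j := by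
    funext j
    rw [vecMul_diagonal]
    simp [div_eq_mul_inv]
  have e4 : star v ⬝ᵥ (fun j => v j / d j) = (q : ℂ) := by
    simp only [dotProduct, hq, Complex.ofReal_sum]
    refine Finset.sum_congr rfl fun j _ => ?_
    rw [Complex.ofReal_div, ← Complex.normSq_eq_norm_sq, ← Complex.mul_conj]
    simp
    ring
  rw [add_mul, mul_sub, mul_sub, e1, Matrix.mul_smul, mul_vecMulVec, e2, Matrix.smul_mul,
    vecMulVec_mul, e3, Matrix.smul_mul, Matrix.mul_smul, vecMulVec_mul_vecMulVec, e4,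
    vecMulVec_smul]
  have hne : (1 + t * q : ℂ) ≠ 0 := by exact_mod_cast ht.ne'
  generalize vecMulVec v (star fun j => v j / (d j : ℂ)) = W
  have : (t : ℂ) = ((t / (1 + t * q) : ℝ) : ℂ) + t * (((t / (1 + t * q) : ℝ) : ℂ) * q) := by
    push_cast
    field_simp
  rw [smul_smul, smul_smul, sub_add_sub_comm]
  nth_rewrite 1 [this]
  module

theorem potentialLE_diagonal_add_smul_vecMulVec [DecidableEq n] (d : n → ℝ)
    (hd : ∀ j, 0 < d j) (v : n → ℂ) (t ε : ℝ) (ht : 0 < 1 + t * ∑ j, ‖v j‖ ^ 2 / d j)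
    (hε : ∑ j, (d j)⁻¹ -
      t * (∑ j, ‖v j‖ ^ 2 / d j ^ 2) / (1 + t * ∑ j, ‖v j‖ ^ 2 / d j) ≤ ε) :
    PotentialLE ((diagonal fun j => (d j : ℂ)) + (t : ℂ) • vecMulVec v (star v)) ε := by
  refine ⟨.of_dotProduct_mulVec_pos ?_ fun x hx => ?_, ?_⟩
  · refine IsHermitian.add ?_ ?_
    · refine isHermitian_diagonal_of_self_adjoint _ ?_
      funext j
      simp
    · unfold IsHermitian
      rw [conjTranspose_smul, conjTranspose_vecMulVec]
      simp
  · rw [add_mulVec, dotProduct_add, smul_mulVec, dotProduct_smul,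
      star_dotProduct_vecMulVec_mulVec, star_dotProduct_diagonal_mulVec, smul_eq_mul]
    norm_cast
    have hcs := norm_dotProduct_sq_le d hd v x
    have hpos : 0 < ∑ j, d j * ‖x j‖ ^ 2 := by
      obtain ⟨j, hj⟩ := Function.ne_iff.mp hx
      refine Finset.sum_pos' (fun i _ => ?_) ⟨j, Finset.mem_univ _, ?_⟩
      · have := (hd i).le
        positivity
      · have := hd j
        have : 0 < ‖x j‖ := norm_pos_iff.mpr hj
        positivity
    rcases le_or_gt 0 t with h | h
    · positivity
    · nlinarith [mul_pos hpos ht]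
  · rw [inv_diagonal_add_smul_vecMulVec d hd v t ht, trace_sub, trace_smul, trace_diagonal]
    have : trace (vecMulVec (fun j => v j / (d j : ℂ)) (star fun j => v j / (d j : ℂ))) =
        ((∑ j, ‖v j‖ ^ 2 / d j ^ 2 : ℝ) : ℂ) := by
      rw [trace_vecMulVec, dotProduct, Complex.ofReal_sum]
      refine Finset.sum_congr rfl fun j _ => ?_
      rw [Pi.star_apply, Complex.star_def, Complex.mul_conj, Complex.normSq_eq_norm_sq, norm_div,
        div_pow]
      simp
    rw [this, smul_eq_mul, ← Complex.ofReal_mul, Complex.sub_re, Complex.ofReal_re, Complex.re_sum]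
    refine le_trans (le_of_eq ?_) hε
    congr 1
    · refine Finset.sum_congr rfl fun j _ => ?_
      rw [← Complex.ofReal_inv, Complex.ofReal_re]
    · ring

theorem mul_sum_inv_add_sq_le (d : n → ℝ) (hd : ∀ j, 0 < d j) (δ : ℝ) (hδ : 0 < δ) :
    δ * ∑ j, ((d j + δ)⁻¹) ^ 2 ≤ ∑ j, (d j)⁻¹ - ∑ j, (d j + δ)⁻¹ := by
  rw [Finset.mul_sum, ← Finset.sum_sub_distrib]
  refine Finset.sum_le_sum fun j _ => ?_
  have h := hd j
  rw [← sub_nonneg]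
  have : (d j)⁻¹ - (d j + δ)⁻¹ - δ * ((d j + δ)⁻¹) ^ 2 = δ ^ 2 / (d j * (d j + δ) ^ 2) := by
    field_simp
    ring
  rw [this]
  positivity

theorem mul_inv_add_le_sum_inv_sq (d : n → ℝ) (hd : ∀ j, 0 < d j) (δ : ℝ) (hδ : 0 < δ)
    (h : δ * ∑ j, (d j + δ)⁻¹ ≤ 1) :
    (∑ j, (d j)⁻¹ - ∑ j, (d j + δ)⁻¹) * (1 / δ + (∑ j, (d j)⁻¹ - ∑ j, (d j + δ)⁻¹)) ≤
      ∑ j, ((d j)⁻¹) ^ 2 := by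
  have hΔ : ∑ j, (d j)⁻¹ - ∑ j, (d j + δ)⁻¹ = δ * ∑ j, (d j + δ)⁻¹ * (d j)⁻¹ := by
    rw [Finset.mul_sum, ← Finset.sum_sub_distrib]
    refine Finset.sum_congr rfl fun j _ => ?_
    have := hd j
    field_simp
    ring
  have hcs : (∑ j, (d j + δ)⁻¹ * (d j)⁻¹) ^ 2 ≤
      (∑ j, (d j + δ)⁻¹) * ∑ j, (d j + δ)⁻¹ * ((d j)⁻¹) ^ 2 := by
    refine Finset.sum_sq_le_sum_mul_sum_of_sq_le_mul _ (fun j _ => ?_) (fun j _ => ?_)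
      fun j _ => le_of_eq (by ring)
    all_goals
      have := hd j
      positivity
  have hsq : ∑ j, ((d j)⁻¹) ^ 2 =
      ∑ j, (d j + δ)⁻¹ * (d j)⁻¹ + δ * ∑ j, (d j + δ)⁻¹ * ((d j)⁻¹) ^ 2 := by
    rw [Finset.mul_sum, ← Finset.sum_add_distrib]
    refine Finset.sum_congr rfl fun j _ => ?_
    have := hd j
    field_simp
  have hT : 0 ≤ ∑ j, (d j + δ)⁻¹ * ((d j)⁻¹) ^ 2 := Finset.sum_nonneg fun j _ => by
    have := hd j
    positivity
  rw [hΔ, hsq]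
  set S := ∑ j, (d j + δ)⁻¹ * (d j)⁻¹
  set T := ∑ j, (d j + δ)⁻¹ * ((d j)⁻¹) ^ 2
  set R := ∑ j, (d j + δ)⁻¹
  have h1 : δ * S * (1 / δ + δ * S) = S + δ * (δ * S ^ 2) := by field_simp
  rw [h1]
  have h2 : δ * S ^ 2 ≤ T := calc
    δ * S ^ 2 ≤ δ * (R * T) := by gcongr
    _ = (δ * R) * T := by ring
    _ ≤ 1 * T := by gcongr
    _ = T := one_mul T
  gcongr

theorem exists_le_and_pos_of_sum_le [Fintype ι] (U L : ι → ℝ) (hU : ∀ i, 0 ≤ U i)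
    (hle : ∑ i, U i ≤ ∑ i, L i) (hpos : 0 < ∑ i, L i) : ∃ i, U i ≤ L i ∧ 0 < L i := by
  by_contra! hcon
  obtain ⟨i, -, hi⟩ := Finset.exists_lt_of_sum_lt (s := Finset.univ)
    (f := fun _ : ι => (0 : ℝ)) (g := L) (by simpa using hpos)
  have : ∑ i, L i < ∑ i, U i := Finset.sum_lt_sum
    (fun k _ => le_of_not_gt fun h => absurd (hcon k h.le) (not_le.mpr ((hU k).trans_lt h)))
    ⟨i, Finset.mem_univ i, lt_of_not_ge fun h => absurd (hcon i h) (not_le.mpr hi)⟩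
  linarith

theorem sum_sum_mul_eq_sum [Fintype ι] (w : ι → n → ℝ) (hw : ∀ j, ∑ i, w i j = 1) (g : n → ℝ) :
    ∑ i, ∑ j, w i j * g j = ∑ j, g j := by
  rw [Finset.sum_comm]
  refine Finset.sum_congr rfl fun j _ => ?_
  rw [← Finset.sum_mul, hw, one_mul]

theorem exists_barrier_step_diagonal [Fintype ι] [DecidableEq n] [Nonempty n] (v : ι → n → ℂ)
    (hv : ∀ j, ∑ i, ‖v i j‖ ^ 2 = 1) (lam : n → ℝ) {l u δl δu εl εu : ℝ}
    (hδl : 0 < δl) (hδu : 0 < δu) (hlt : δl * εl < 1) (hbal : 1 / δu + εu ≤ 1 / δl - εl)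
    (hl : ∀ j, l < lam j) (hu : ∀ j, lam j < u)
    (hpl : ∑ j, (lam j - l)⁻¹ ≤ εl) (hpu : ∑ j, (u - lam j)⁻¹ ≤ εu) :
    ∃ i, ∃ t : ℝ, 0 < t ∧
      PotentialLE ((diagonal fun j => ((lam j - (l + δl) : ℝ) : ℂ)) +
        (t : ℂ) • vecMulVec (v i) (star (v i))) εl ∧
      PotentialLE ((diagonal fun j => ((u + δu - lam j : ℝ) : ℂ)) +
        ((-t : ℝ) : ℂ) • vecMulVec (v i) (star (v i))) εu := by
  have hεl : 0 < εl := lt_of_lt_of_le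
    (Finset.sum_pos (fun j _ => inv_pos.mpr (sub_pos.mpr (hl j))) Finset.univ_nonempty) hpl
  have hl' : ∀ j, 0 < lam j - (l + δl) := fun j => by
    have h0 : 0 < lam j - l := sub_pos.mpr (hl j)
    have h1 : (lam j - l)⁻¹ ≤ εl := le_trans
      (Finset.single_le_sum (f := fun j => (lam j - l)⁻¹)
        (fun i _ => (inv_pos.mpr (sub_pos.mpr (hl i))).le) (Finset.mem_univ j)) hpl
    have h2 : 1 ≤ εl * (lam j - l) := by
      rwa [inv_eq_one_div, div_le_iff₀ h0] at h1
    have h3 : εl * δl < εl * (lam j - l) := by linarith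
    have := lt_of_mul_lt_mul_left h3 hεl.le
    linarith
  have hu' : ∀ j, 0 < u + δu - lam j := fun j => by linarith [hu j]
  have hU := mul_sum_inv_add_sq_le (fun j => u - lam j) (fun j => sub_pos.mpr (hu j)) δu hδu
  have hL := mul_inv_add_le_sum_inv_sq (fun j => lam j - (l + δl)) hl' δl hδl
  simp only [show ∀ j, lam j - (l + δl) + δl = lam j - l from fun j => by ring] at hL
  simp only [show ∀ j, u - lam j + δu = u + δu - lam j from fun j => by ring] at hU
  specialize hL (le_trans (by gcongr) hlt.le)
  have hF : 0 < ∑ j, ((u + δu - lam j)⁻¹) ^ 2 :=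
    Finset.sum_pos (fun j _ => pow_pos (inv_pos.mpr (hu' j)) 2) Finset.univ_nonempty
  have hΔl : 0 < ∑ j, (lam j - (l + δl))⁻¹ - ∑ j, (lam j - l)⁻¹ := by
    rw [sub_pos]
    refine Finset.sum_lt_sum_of_nonempty Finset.univ_nonempty fun j _ => ?_
    exact inv_strictAnti₀ (hl' j) (by linarith)
  set Δl := ∑ j, (lam j - (l + δl))⁻¹ - ∑ j, (lam j - l)⁻¹ with hΔl_def
  set Δu := ∑ j, (u - lam j)⁻¹ - ∑ j, (u + δu - lam j)⁻¹ with hΔu_def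
  have hΔu : 0 < Δu := lt_of_lt_of_le (mul_pos hδu hF) hU
  let pl : ι → ℝ := fun i => ∑ j, ‖v i j‖ ^ 2 / (lam j - (l + δl)) ^ 2
  let ql : ι → ℝ := fun i => ∑ j, ‖v i j‖ ^ 2 / (lam j - (l + δl))
  let pu : ι → ℝ := fun i => ∑ j, ‖v i j‖ ^ 2 / (u + δu - lam j) ^ 2
  let qu : ι → ℝ := fun i => ∑ j, ‖v i j‖ ^ 2 / (u + δu - lam j)
  have hpl_sum : ∑ i, pl i = ∑ j, ((lam j - (l + δl))⁻¹) ^ 2 := by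
    simp only [pl, div_eq_mul_inv, ← inv_pow]
    exact sum_sum_mul_eq_sum _ hv _
  have hql_sum : ∑ i, ql i = ∑ j, (lam j - (l + δl))⁻¹ := by
    simp only [ql, div_eq_mul_inv]
    exact sum_sum_mul_eq_sum _ hv _
  have hpu_sum : ∑ i, pu i = ∑ j, ((u + δu - lam j)⁻¹) ^ 2 := by
    simp only [pu, div_eq_mul_inv, ← inv_pow]
    exact sum_sum_mul_eq_sum _ hv _
  have hqu_sum : ∑ i, qu i = ∑ j, (u + δu - lam j)⁻¹ := by
    simp only [qu, div_eq_mul_inv]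
    exact sum_sum_mul_eq_sum _ hv _
  have hpl0 : ∀ i, 0 ≤ pl i := fun i => Finset.sum_nonneg fun j _ => by positivity
  have hpu0 : ∀ i, 0 ≤ pu i := fun i => Finset.sum_nonneg fun j _ => by positivity
  have hql0 : ∀ i, 0 ≤ ql i := fun i => Finset.sum_nonneg fun j _ =>
    div_nonneg (sq_nonneg _) (hl' j).le
  have hqu0 : ∀ i, 0 ≤ qu i := fun i => Finset.sum_nonneg fun j _ =>
    div_nonneg (sq_nonneg _) (hu' j).le
  have hsumU : ∑ i, (pu i / Δu + qu i) ≤ 1 / δu + εu := by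
    rw [Finset.sum_add_distrib, ← Finset.sum_div, hpu_sum, hqu_sum]
    have h1 : (∑ j, ((u + δu - lam j)⁻¹) ^ 2) / Δu ≤ 1 / δu := by
      rw [div_le_div_iff₀ hΔu hδu]
      linarith
    linarith
  have hsumL : 1 / δl - εl ≤ ∑ i, (pl i / Δl - ql i) := by
    rw [Finset.sum_sub_distrib, ← Finset.sum_div, hpl_sum, hql_sum]
    have h1 : 1 / δl + Δl ≤ (∑ j, ((lam j - (l + δl))⁻¹) ^ 2) / Δl := by
      rw [le_div_iff₀ hΔl]
      linarith
    linarith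
  have hpos : 0 < 1 / δl - εl := by
    rw [sub_pos, lt_div_iff₀ hδl]
    linarith
  obtain ⟨i, hi, hLi⟩ := exists_le_and_pos_of_sum_le (fun i => pu i / Δu + qu i)
    (fun i => pl i / Δl - ql i)
    (fun i => add_nonneg (div_nonneg (hpu0 i) hΔu.le) (hqu0 i))
    (hsumU.trans (hbal.trans hsumL)) (hpos.trans_le hsumL)
  have hpli : 0 < pl i := by
    have : 0 < pl i / Δl := by linarith [hql0 i]
    exact (div_pos_iff_of_pos_right hΔl).mp this
  have hpui : 0 < pu i := by
    obtain ⟨j, -, hj⟩ := Finset.exists_ne_zero_of_sum_ne_zero hpli.ne'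
    have hvj : ‖v i j‖ ^ 2 ≠ 0 := fun h => hj (by rw [h, zero_div])
    refine Finset.sum_pos' (fun j _ => by positivity) ⟨j, Finset.mem_univ j, ?_⟩
    have := hu' j
    positivity
  set c := pl i / Δl - ql i with hc
  have hcu : pu i / Δu + qu i ≤ c := hi
  have hpuΔ : 0 < pu i / Δu := div_pos hpui hΔu
  refine ⟨i, c⁻¹, inv_pos.mpr hLi, ?_, ?_⟩
  · have hden : 0 < 1 + c⁻¹ * ql i := by
      have := inv_pos.mpr hLi
      have := hql0 i
      positivity
    refine potentialLE_diagonal_add_smul_vecMulVec _ hl' (v i) _ _ hden ?_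
    have key : Δl ≤ c⁻¹ * pl i / (1 + c⁻¹ * ql i) := by
      rw [le_div_iff₀ hden]
      have : pl i = (c + ql i) * Δl := by
        rw [hc]
        field_simp
        ring
      rw [this]
      apply le_of_eq
      field_simp
    change _ - c⁻¹ * pl i / (1 + c⁻¹ * ql i) ≤ εl
    linarith
  · have hden : 0 < 1 + -c⁻¹ * qu i := by
      have : c⁻¹ * qu i < 1 := by
        rw [inv_mul_lt_iff₀ hLi]
        linarith
      linarith
    refine potentialLE_diagonal_add_smul_vecMulVec _ hu' (v i) _ _ hden ?_
    have key : c⁻¹ * pu i / (1 + -c⁻¹ * qu i) ≤ Δu := by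
      rw [div_le_iff₀ hden]
      have h1 : pu i ≤ (c - qu i) * Δu := by
        rw [← div_le_iff₀ hΔu]
        linarith
      calc c⁻¹ * pu i ≤ c⁻¹ * ((c - qu i) * Δu) := by gcongr
        _ = Δu * (1 + -c⁻¹ * qu i) := by field_simp; ring
    change _ - -c⁻¹ * pu i / (1 + -c⁻¹ * qu i) ≤ εu
    rw [neg_mul, neg_div]
    linarith

theorem mul_vecMulVec_star_mul_star (U : Matrix n n ℂ) (w : n → ℂ) :
    U * vecMulVec w (star w) * star U = vecMulVec (U *ᵥ w) (star (U *ᵥ w)) := by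
  rw [mul_vecMulVec, vecMulVec_mul, star_mulVec, star_eq_conjTranspose]

theorem exists_barrier_step [Fintype ι] [DecidableEq n] [Nonempty n] (v : ι → n → ℂ)
    (hv : ∑ i, vecMulVec (v i) (star (v i)) = 1) (A : Matrix n n ℂ) (hA : A.IsHermitian)
    {l u δl δu εl εu : ℝ} (hδl : 0 < δl) (hδu : 0 < δu) (hlt : δl * εl < 1)
    (hbal : 1 / δu + εu ≤ 1 / δl - εl)
    (hl : PotentialLE (A - (l : ℂ) • 1) εl) (hu : PotentialLE ((u : ℂ) • 1 - A) εu) :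
    ∃ i, ∃ t : ℝ, 0 < t ∧
      PotentialLE (A + (t : ℂ) • vecMulVec (v i) (star (v i)) - ((l + δl : ℝ) : ℂ) • 1) εl ∧
      PotentialLE (((u + δu : ℝ) : ℂ) • 1 - (A + (t : ℂ) • vecMulVec (v i) (star (v i)))) εu := by
  set U := hA.eigenvectorUnitary with hU_def
  set lam := hA.eigenvalues with hlam_def
  have hspec : A = (U : Matrix n n ℂ) * (diagonal fun j => (lam j : ℂ)) *
      star (U : Matrix n n ℂ) := by
    have h := hA.spectral_theorem
    rw [Unitary.conjStarAlgAut_apply] at h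
    exact h
  have h1 : (U : Matrix n n ℂ) * star (U : Matrix n n ℂ) = 1 := Unitary.mul_star_self_of_mem U.2
  have h2 : star (U : Matrix n n ℂ) * (U : Matrix n n ℂ) = 1 := Unitary.star_mul_self_of_mem U.2
  have hsub : ∀ c : ℝ, A - (c : ℂ) • 1 = (U : Matrix n n ℂ) *
      (diagonal fun j => ((lam j - c : ℝ) : ℂ)) * star (U : Matrix n n ℂ) := fun c => by
    have : (diagonal fun j => ((lam j - c : ℝ) : ℂ)) =
        (diagonal fun j => (lam j : ℂ)) - (c : ℂ) • (1 : Matrix n n ℂ) := by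
      rw [smul_one_eq_diagonal, diagonal_sub]
      simp
    rw [this, mul_sub, sub_mul, ← hspec, Matrix.mul_smul, Matrix.smul_mul, Matrix.mul_one, h1]
  have hsub' : ∀ c : ℝ, (c : ℂ) • 1 - A = (U : Matrix n n ℂ) *
      (diagonal fun j => ((c - lam j : ℝ) : ℂ)) * star (U : Matrix n n ℂ) := fun c => by
    rw [← neg_sub, hsub, ← neg_mul, ← mul_neg, diagonal_neg]
    congr 3
    funext j
    simp
  rw [hsub, potentialLE_unitary_conj, potentialLE_diagonal_iff] at hl
  rw [hsub', potentialLE_unitary_conj, potentialLE_diagonal_iff] at hu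
  have hw : ∀ j, ∑ i, ‖(star (U : Matrix n n ℂ) *ᵥ v i) j‖ ^ 2 = 1 := fun j => by
    have h3 : ∑ i, vecMulVec (star (U : Matrix n n ℂ) *ᵥ v i)
        (star (star (U : Matrix n n ℂ) *ᵥ v i)) = 1 := by
      simp_rw [← mul_vecMulVec_star_mul_star]
      rw [← Finset.sum_mul, ← Finset.mul_sum, hv, star_star, Matrix.mul_one, h2]
    have h4 := congrFun (congrFun h3 j) j
    rw [Matrix.sum_apply, one_apply_eq] at h4
    simp only [vecMulVec_apply, Pi.star_apply, Complex.star_def, Complex.mul_conj,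
      Complex.normSq_eq_norm_sq] at h4
    exact_mod_cast h4
  obtain ⟨i, t, ht, hL, hR⟩ := exists_barrier_step_diagonal
    (fun i => star (U : Matrix n n ℂ) *ᵥ v i) hw lam hδl hδu hlt hbal
    (fun j => sub_pos.mp (hl.1 j)) (fun j => sub_pos.mp (hu.1 j)) hl.2 hu.2
  have hvi : (U : Matrix n n ℂ) * vecMulVec (star (U : Matrix n n ℂ) *ᵥ v i)
      (star (star (U : Matrix n n ℂ) *ᵥ v i)) * star (U : Matrix n n ℂ) =
      vecMulVec (v i) (star (v i)) := by
    rw [mul_vecMulVec_star_mul_star, mulVec_mulVec, h1, one_mulVec]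
  refine ⟨i, t, ht, ?_, ?_⟩
  · rw [← potentialLE_unitary_conj U, mul_add, add_mul, ← hsub, Matrix.mul_smul, Matrix.smul_mul,
      hvi] at hL
    rwa [add_sub_right_comm]
  · rw [← potentialLE_unitary_conj U, mul_add, add_mul, ← hsub', Matrix.mul_smul, Matrix.smul_mul,
      hvi, Complex.ofReal_neg, neg_smul, ← sub_eq_add_neg] at hR
    rwa [← sub_sub]

theorem isHermitian_sum_smul_vecMulVec {n : Type*} [Fintype ι] (v : ι → n → ℂ) (s : ι → ℝ) :
    (∑ i, (s i : ℂ) • vecMulVec (v i) (star (v i))).IsHermitian := by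
  unfold IsHermitian
  rw [conjTranspose_sum]
  refine Finset.sum_congr rfl fun i _ => ?_
  rw [conjTranspose_smul, conjTranspose_vecMulVec]
  simp

theorem exists_weights_potentialLE [Fintype ι] [DecidableEq ι] [DecidableEq n] [Nonempty n]
    (v : ι → n → ℂ) (hv : ∑ i, vecMulVec (v i) (star (v i)) = 1) {l u δl δu εl εu : ℝ}
    (hδl : 0 < δl) (hδu : 0 < δu) (hlt : δl * εl < 1) (hbal : 1 / δu + εu ≤ 1 / δl - εl)
    (hl : PotentialLE (0 - (l : ℂ) • (1 : Matrix n n ℂ)) εl)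
    (hu : PotentialLE ((u : ℂ) • (1 : Matrix n n ℂ) - 0) εu) (N : ℕ) :
    ∃ s : ι → ℝ, (∀ i, 0 ≤ s i) ∧ (Finset.univ.filter fun i => s i ≠ 0).card ≤ N ∧
      PotentialLE (∑ i, (s i : ℂ) • vecMulVec (v i) (star (v i)) -
        ((l + N * δl : ℝ) : ℂ) • 1) εl ∧
      PotentialLE (((u + N * δu : ℝ) : ℂ) • 1 -
        ∑ i, (s i : ℂ) • vecMulVec (v i) (star (v i))) εu := by
  induction N with
  | zero => exact ⟨0, fun i => le_rfl, by simp, by simpa using hl, by simpa using hu⟩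
  | succ N ih =>
    obtain ⟨s, hs, hcard, hL, hR⟩ := ih
    obtain ⟨i, t, ht, hL', hR'⟩ := exists_barrier_step v hv _
      (isHermitian_sum_smul_vecMulVec v s) hδl hδu hlt hbal hL hR
    have hsum : ∑ k, (((s + Pi.single i t : ι → ℝ) k : ℝ) : ℂ) • vecMulVec (v k) (star (v k)) =
        ∑ k, (s k : ℂ) • vecMulVec (v k) (star (v k)) +
          (t : ℂ) • vecMulVec (v i) (star (v i)) := by
      simp only [Pi.add_apply, Complex.ofReal_add, add_smul, Finset.sum_add_distrib]
      congr 1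
      rw [Finset.sum_eq_single i]
      · simp
      · intro k _ hk
        simp [hk]
      · simp
    refine ⟨s + Pi.single i t, fun k => ?_, ?_, ?_, ?_⟩
    · exact add_nonneg (hs k) ((Pi.single_nonneg (α := fun _ : ι => ℝ)).mpr ht.le k)
    · refine (Finset.card_le_card (t := insert i (Finset.univ.filter fun k => s k ≠ 0))
        fun k hk => ?_).trans ((Finset.card_insert_le _ _).trans (by lia))
      by_cases hki : k = i
      · simp [hki]
      · simpa [hki] using hk
    · rw [hsum]
      convert hL' using 4
      push_cast
      ring
    · rw [hsum]
      convert hR' using 4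
      push_cast
      ring

theorem star_dotProduct_sum_smul_vecMulVec_mulVec [Fintype ι] (v : ι → n → ℂ) (s : ι → ℝ)
    (x : n → ℂ) :
    star x ⬝ᵥ ((∑ i, (s i : ℂ) • vecMulVec (v i) (star (v i))) *ᵥ x) =
      ((∑ i, s i * ‖star (v i) ⬝ᵥ x‖ ^ 2 : ℝ) : ℂ) := by
  rw [sum_mulVec, dotProduct_sum, Complex.ofReal_sum]
  refine Finset.sum_congr rfl fun i _ => ?_
  rw [smul_mulVec, dotProduct_smul, star_dotProduct_vecMulVec_mulVec, smul_eq_mul,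
    Complex.ofReal_mul]

theorem star_dotProduct_smul_one_mulVec [DecidableEq n] (c : ℝ) (x : n → ℂ) :
    star x ⬝ᵥ (((c : ℂ) • (1 : Matrix n n ℂ)) *ᵥ x) = ((c * ∑ j, ‖x j‖ ^ 2 : ℝ) : ℂ) := by
  rw [smul_one_eq_diagonal, star_dotProduct_diagonal_mulVec (fun _ => c), Finset.mul_sum]

/-- Spectral sparsification of a decomposition of the identity: `N ≥ b d` weighted terms, where
`d` bounds the dimension, suffice for a condition number of `(√b + 1)² / (√b - 1)²`. -/
theorem exists_weights_sparsify [Fintype ι] [DecidableEq ι] [DecidableEq n] [Nonempty n]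
    (v : ι → n → ℂ) (hv : ∑ i, vecMulVec (v i) (star (v i)) = 1) {b d : ℝ} (hb : 1 < b)
    (hd : Fintype.card n ≤ d) (N : ℕ) (hN : b * d ≤ N) :
    ∃ (s : ι → ℝ) (c C : ℝ), (∀ i, 0 ≤ s i) ∧
      (Finset.univ.filter fun i => s i ≠ 0).card ≤ N ∧ 0 < c ∧
      C ≤ (√b + 1) ^ 2 / (√b - 1) ^ 2 * c ∧ ∀ x : n → ℂ,
        c * ∑ j, ‖x j‖ ^ 2 ≤ ∑ i, s i * ‖star (v i) ⬝ᵥ x‖ ^ 2 ∧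
        ∑ i, s i * ‖star (v i) ⬝ᵥ x‖ ^ 2 ≤ C * ∑ j, ‖x j‖ ^ 2 := by
  have hd0 : 0 < d := lt_of_lt_of_le (by exact_mod_cast Fintype.card_pos) hd
  obtain ⟨r, hr⟩ : ∃ r, r = √b := ⟨_, rfl⟩
  have hr1 : 1 < r := by
    rw [hr]
    exact Real.lt_sqrt_of_sq_lt (by simpa using hb)
  have hbr : b = r ^ 2 := by rw [hr, Real.sq_sqrt (by linarith)]
  have hr0 : 0 < r := by linarith
  have hrm : 0 < r - 1 := by linarith
  rw [← hr]
  rw [hbr] at hN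
  have hstart_l : PotentialLE (0 - ((-(d * r) : ℝ) : ℂ) • (1 : Matrix n n ℂ)) (1 / r) := by
    rw [zero_sub, ← neg_smul, ← Complex.ofReal_neg, neg_neg, smul_one_eq_diagonal,
      potentialLE_diagonal_iff (fun _ => d * r)]
    refine ⟨fun _ => by positivity, ?_⟩
    rw [Finset.sum_const, nsmul_eq_mul, Finset.card_univ, ← div_eq_mul_inv,
      div_le_div_iff₀ (by positivity) hr0]
    nlinarith
  have hstart_u : PotentialLE (((d * r * (r + 1) / (r - 1) : ℝ) : ℂ) • (1 : Matrix n n ℂ) - 0)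
      ((r - 1) / (r * (r + 1))) := by
    rw [sub_zero, smul_one_eq_diagonal,
      potentialLE_diagonal_iff (fun _ => d * r * (r + 1) / (r - 1))]
    refine ⟨fun _ => by positivity, ?_⟩
    rw [Finset.sum_const, nsmul_eq_mul, Finset.card_univ]
    calc (Fintype.card n : ℝ) * (d * r * (r + 1) / (r - 1))⁻¹
        ≤ d * (d * r * (r + 1) / (r - 1))⁻¹ := by gcongr
      _ = (r - 1) / (r * (r + 1)) := by field_simp
  obtain ⟨s, hs, hcard, hL, hR⟩ := exists_weights_potentialLE v hv (δl := 1)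
    (δu := (r + 1) / (r - 1)) one_pos (by positivity)
    (by rw [one_mul, div_lt_one hr0]; exact hr1)
    (by apply le_of_eq; field_simp) hstart_l hstart_u N
  refine ⟨s, -(d * r) + N * 1, d * r * (r + 1) / (r - 1) + N * ((r + 1) / (r - 1)), hs, hcard,
    ?_, ?_, fun x => ⟨?_, ?_⟩⟩
  rotate_left 2
  · have h := hL.1.posSemidef.dotProduct_mulVec_nonneg x
    rw [sub_mulVec, dotProduct_sub, star_dotProduct_sum_smul_vecMulVec_mulVec,
      star_dotProduct_smul_one_mulVec, sub_nonneg, Complex.real_le_real] at h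
    exact h
  · have h := hR.1.posSemidef.dotProduct_mulVec_nonneg x
    rw [sub_mulVec, dotProduct_sub, star_dotProduct_sum_smul_vecMulVec_mulVec,
      star_dotProduct_smul_one_mulVec, sub_nonneg, Complex.real_le_real] at h
    exact h
  · nlinarith [mul_pos hd0 (mul_pos hr0 hrm)]
  · rw [div_mul_eq_mul_div, le_div_iff₀ (by positivity)]
    have h : (d * r * (r + 1) / (r - 1) + N * ((r + 1) / (r - 1))) * (r - 1) ^ 2 =
        (r + 1) * (r - 1) * (d * r + N) := by
      field_simp
    rw [h]
    have : (r + 1) ^ 2 * (-(d * r) + N * 1) - (r + 1) * (r - 1) * (d * r + N) =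
        2 * (r + 1) * (N - r ^ 2 * d) := by ring
    have : 0 ≤ 2 * (r + 1) * (N - r ^ 2 * d) := mul_nonneg (by positivity) (by linarith)
    linarith

/-- The analysis map of a finite family factors through that of a Parseval frame of its range. -/
theorem exists_parseval_factorization {κ : Type*} [Fintype κ] [Fintype ι] (y : ι → κ → ℂ) :
    ∃ k ≤ Fintype.card κ, ∃ v : ι → Fin k → ℂ, ∑ i, vecMulVec (v i) (star (v i)) = 1 ∧
      ∀ a : κ → ℂ, ∃ x : Fin k → ℂ, ∀ i, star (v i) ⬝ᵥ x = star (y i) ⬝ᵥ a := by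
  let T : (κ → ℂ) →ₗ[ℂ] EuclideanSpace ℂ ι :=
    (WithLp.linearEquiv 2 ℂ (ι → ℂ)).symm.toLinearMap ∘ₗ
      (Matrix.of fun i => star (y i)).mulVecLin
  let q := stdOrthonormalBasis ℂ (LinearMap.range T)
  refine ⟨Module.finrank ℂ (LinearMap.range T), ?_,
    fun i j => star ((q j : EuclideanSpace ℂ ι) i), ?_, fun a => ?_⟩
  · simpa using LinearMap.finrank_range_le T
  · ext j j'
    have h := orthonormal_iff_ite.mp q.orthonormal j j'
    rw [Submodule.coe_inner, PiLp.inner_apply] at h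
    rw [Matrix.sum_apply, Matrix.one_apply, ← h]
    refine Finset.sum_congr rfl fun i _ => ?_
    simp [vecMulVec_apply, mul_comm]
  · refine ⟨fun j => q.repr ⟨T a, LinearMap.mem_range_self T a⟩ j, fun i => ?_⟩
    have h := congrArg (fun z : LinearMap.range T => (z : EuclideanSpace ℂ ι) i)
      (q.sum_repr ⟨T a, LinearMap.mem_range_self T a⟩)
    simp only [Submodule.coe_sum, Submodule.coe_smul, WithLp.ofLp_sum, Finset.sum_apply,
      PiLp.smul_apply, smul_eq_mul] at h
    refine Eq.trans ?_ h
    refine Finset.sum_congr rfl fun j _ => ?_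
    rw [Pi.star_apply, star_star, mul_comm]

end BarrierMethod

/-- Unweighted subsampling of a Bessel sequence (Lemma `l:nonweighted_bss`). -/
theorem stmt_11 (m M : ℕ) (hMm : m ≤ M) (y : Fin M → Fin m → ℂ) (B β : ℝ)
    (hB : 0 < B) (hβ : 0 < β)
    (hbessel : ∀ x : Fin m → ℂ,
      ∑ i, ‖star (y i) ⬝ᵥ x‖ ^ 2 ≤ B * ∑ j, ‖x j‖ ^ 2)
    (hnorm : ∀ i, β * m / M ≤ ∑ j, ‖y i j‖ ^ 2)
    (b : ℝ) (hb : 1 < b) :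
    ∃ J : Finset (Fin M), J.card ≤ ⌈b * m⌉₊ ∧
      ∀ a : Fin m → ℂ,
        (1 / M) * ∑ i, ‖star (y i) ⬝ᵥ a‖ ^ 2 ≤
          B / β * ((Real.sqrt b + 1) ^ 2 / (Real.sqrt b - 1) ^ 2) *
            ((1 / m) * ∑ i ∈ J, ‖star (y i) ⬝ᵥ a‖ ^ 2) := by
  obtain ⟨k, hk, v, hv, hfac⟩ := BarrierMethod.exists_parseval_factorization y
  rw [Fintype.card_fin] at hk
  rcases Nat.eq_zero_or_pos k with rfl | hk0
  · refine ⟨∅, by simp, fun a => ?_⟩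
    obtain ⟨x, hx⟩ := hfac a
    simp [← hx]
  have : Nonempty (Fin k) := ⟨⟨0, hk0⟩⟩
  have hm : (0 : ℝ) < m := by exact_mod_cast hk0.trans_le hk
  have hM : (0 : ℝ) < M := by exact_mod_cast hk0.trans_le (hk.trans hMm)
  obtain ⟨s, c, C, hs, hcard, hc, hC, hbound⟩ :=
    BarrierMethod.exists_weights_sparsify v hv hb (d := m) (by simpa using hk) ⌈b * m⌉₊
      (Nat.le_ceil _)
  have hframe : ∀ a, c * ∑ i, ‖star (y i) ⬝ᵥ a‖ ^ 2 ≤ ∑ i, s i * ‖star (y i) ⬝ᵥ a‖ ^ 2 ∧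
      ∑ i, s i * ‖star (y i) ⬝ᵥ a‖ ^ 2 ≤ C * ∑ i, ‖star (y i) ⬝ᵥ a‖ ^ 2 := fun a => by
    obtain ⟨x, hx⟩ := hfac a
    have hpars : ∑ i, ‖star (v i) ⬝ᵥ x‖ ^ 2 = ∑ j, ‖x j‖ ^ 2 := by
      have h := BarrierMethod.star_dotProduct_sum_smul_vecMulVec_mulVec v (fun _ => 1) x
      have h' := BarrierMethod.star_dotProduct_smul_one_mulVec 1 x
      simp only [Complex.ofReal_one, one_smul, one_mul, hv] at h h'
      exact_mod_cast h.symm.trans h'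
    simp only [← hx]
    rw [hpars]
    exact hbound x
  have hself : ∀ i, ‖star (y i) ⬝ᵥ y i‖ = ∑ j, ‖y i j‖ ^ 2 := fun i => by
    have : star (y i) ⬝ᵥ y i = ((∑ j, ‖y i j‖ ^ 2 : ℝ) : ℂ) := by
      simpa using BarrierMethod.star_dotProduct_smul_one_mulVec 1 (y i)
    rw [this, Complex.norm_real, Real.norm_of_nonneg (Finset.sum_nonneg fun j _ => sq_nonneg _)]
  have hC0 : 0 ≤ C := by
    have h := hbound (fun _ => 1)
    have hpos : (0 : ℝ) < ∑ j : Fin k, ‖(1 : ℂ)‖ ^ 2 := by simpa using hk0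
    exact (pos_of_mul_pos_left ((mul_pos hc hpos).trans_le (h.1.trans h.2)) hpos.le).le
  have hweight : ∀ i, s i ≤ C * B * M / (β * m) := fun i => by
    have hY : 0 < ∑ j, ‖y i j‖ ^ 2 := lt_of_lt_of_le (by positivity) (hnorm i)
    have h1 : s i * (∑ j, ‖y i j‖ ^ 2) ^ 2 ≤ C * (B * ∑ j, ‖y i j‖ ^ 2) := by
      rw [← hself i]
      refine (Finset.single_le_sum (f := fun l => s l * ‖star (y l) ⬝ᵥ y i‖ ^ 2)
        (fun l _ => mul_nonneg (hs l) (sq_nonneg _)) (Finset.mem_univ i)).trans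
        ((hframe (y i)).2.trans (mul_le_mul_of_nonneg_left ?_ hC0))
      rw [hself i]
      exact hbessel (y i)
    have h2 : s i * ∑ j, ‖y i j‖ ^ 2 ≤ C * B := by
      refine le_of_mul_le_mul_right ?_ hY
      linarith
    have h3 : s i * (β * m / M) ≤ C * B := (mul_le_mul_of_nonneg_left (hnorm i) (hs i)).trans h2
    rw [le_div_iff₀ (by positivity)]
    rw [mul_div_assoc', div_le_iff₀ hM] at h3
    exact h3
  refine ⟨Finset.univ.filter fun i => s i ≠ 0, hcard, fun a => ?_⟩
  have hsub : ∑ i, s i * ‖star (y i) ⬝ᵥ a‖ ^ 2 ≤ C * B * M / (β * m) *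
      ∑ i ∈ Finset.univ.filter (fun i => s i ≠ 0), ‖star (y i) ⬝ᵥ a‖ ^ 2 := by
    rw [Finset.mul_sum, ← Finset.sum_filter_of_ne (p := fun i => s i ≠ 0)
      (fun i _ h => left_ne_zero_of_mul h)]
    exact Finset.sum_le_sum fun i _ => mul_le_mul_of_nonneg_right (hweight i) (sq_nonneg _)
  have hS : 0 ≤ ∑ i ∈ Finset.univ.filter (fun i => s i ≠ 0), ‖star (y i) ⬝ᵥ a‖ ^ 2 :=
    Finset.sum_nonneg fun i _ => sq_nonneg _
  set S := ∑ i ∈ Finset.univ.filter (fun i => s i ≠ 0), ‖star (y i) ⬝ᵥ a‖ ^ 2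
  set K := (√b + 1) ^ 2 / (√b - 1) ^ 2
  refine le_of_mul_le_mul_left ?_ (mul_pos hc hM)
  calc c * M * (1 / M * ∑ i, ‖star (y i) ⬝ᵥ a‖ ^ 2)
      = c * ∑ i, ‖star (y i) ⬝ᵥ a‖ ^ 2 := by field_simp
    _ ≤ C * B * M / (β * m) * S := (hframe a).1.trans hsub
    _ ≤ K * c * B * M / (β * m) * S := by gcongr
    _ = c * M * (B / β * K * (1 / m * S)) := by field_simp
end

section
/- Let $(y^i)_{i=1}^M$ be any vectors in $\mathbb{C}^m$ and let $\alpha > 0$ be such that $M / \lceil \alpha m \rceil \in \mathbb{N}$. Then for any $b > 1$ there exists a subset $J \subseteq \{1, \dots, M\}$ (without duplicates) with $|J| \le \lceil b \lceil (1+\alpha) m \rceil \rceil$ such that for all $a \in \mathbb{C}^m$: $\frac{1}{M} \sum_{i=1}^M |\langle a, y^i \rangle|^2 \le \frac{2}{\alpha} \cdot \frac{(\sqrt{b}+1)^2}{(\sqrt{b}-1)^2} \cdot \frac{1}{m} \sum_{i \in J} |\langle a, y^i \rangle|^2$. -/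
open Matrix

section RankOne

open scoped ComplexOrder

variable {n : Type*} [Fintype n]

/-- The rank-one matrix `v v*`. -/
abbrev rankOne (v : n → ℂ) : Matrix n n ℂ := vecMulVec v (star v)

lemma rankOne_mul_mul_rankOne (R : Matrix n n ℂ) (v : n → ℂ) :
    rankOne v * R * rankOne v = (R * rankOne v).trace • rankOne v := by
  rw [vecMulVec_mul, vecMulVec_mul_vecMulVec, mul_vecMulVec, trace_vecMulVec,
    ← dotProduct_mulVec, vecMulVec_smul, dotProduct_comm]

lemma Matrix.PosSemidef.trace_mul_rankOne_nonneg {R : Matrix n n ℂ} (hR : R.PosSemidef)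
    (v : n → ℂ) : 0 ≤ (R * rankOne v).trace := by
  rw [mul_vecMulVec, trace_vecMulVec, dotProduct_comm]
  exact hR.dotProduct_mulVec_nonneg v

lemma star_dotProduct_rankOne_mulVec (v x : n → ℂ) :
    star x ⬝ᵥ (rankOne v *ᵥ x) = ((‖star v ⬝ᵥ x‖ ^ 2 : ℝ) : ℂ) := by
  rw [vecMulVec_mulVec, dotProduct_smul, op_smul_eq_smul, smul_eq_mul,
    Complex.ofReal_pow, ← Complex.mul_conj', ← Complex.star_def, star_dotProduct, star_star]

variable [DecidableEq n]

/-- Trace form of the Sherman–Morrison formula. -/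
lemma Matrix.PosDef.trace_inv_add_smul_rankOne {X : Matrix n n ℂ} (hX : X.PosDef)
    (v : n → ℂ) {s : ℝ} (hs : 0 ≤ s) :
    (X + (s : ℂ) • rankOne v)⁻¹.trace.re = X⁻¹.trace.re -
      s * (X⁻¹ * X⁻¹ * rankOne v).trace.re / (1 + s * (X⁻¹ * rankOne v).trace.re) := by
  set P := rankOne v
  set R := X⁻¹
  have hXR : X * R = 1 := mul_nonsing_inv X ((isUnit_iff_isUnit_det _).1 hX.isUnit)
  have hq := hX.inv.posSemidef.trace_mul_rankOne_nonneg v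
  obtain ⟨q, hq_eq⟩ : ∃ q : ℝ, (R * P).trace = q :=
    ⟨_, (Complex.eq_re_of_ofReal_le (r := 0) (by simpa using hq))⟩
  have hq0 : 0 ≤ q := by
    have := hq
    rw [hq_eq] at this
    exact_mod_cast this
  have hpos : 0 < 1 + s * q := by positivity
  have hne : (1 + s * q : ℂ) ≠ 0 := by exact_mod_cast hpos.ne'
  have hPRP : P * R * P = (q : ℂ) • P := by rw [rankOne_mul_mul_rankOne, hq_eq]
  have hinv : (X + (s : ℂ) • P)⁻¹ = R - ((s / (1 + s * q) : ℝ) : ℂ) • (R * P * R) := by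
    apply inv_eq_right_inv
    have e1 : X * (R * P * R) = P * R := by
      rw [← Matrix.mul_assoc, ← Matrix.mul_assoc, hXR, Matrix.one_mul]
    have e2 : P * (R * P * R) = (q : ℂ) • (P * R) := by
      rw [← Matrix.mul_assoc, ← Matrix.mul_assoc, hPRP, Matrix.smul_mul]
    rw [Matrix.mul_sub, Matrix.add_mul, Matrix.add_mul, hXR, Matrix.mul_smul, Matrix.mul_smul,
      Matrix.smul_mul, Matrix.smul_mul, e1, e2]
    have : (s : ℂ) = ((s / (1 + s * q) : ℝ) : ℂ) + ((s / (1 + s * q) : ℝ) : ℂ) * s * q := by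
      push_cast
      field_simp
    nth_rewrite 1 [this]
    module
  have htr : (R * P * R).trace = (R * R * P).trace := by
    rw [trace_mul_comm, Matrix.mul_assoc]
  rw [hinv, trace_sub, trace_smul, htr, Complex.sub_re, smul_eq_mul, Complex.re_ofReal_mul, hq_eq,
    Complex.ofReal_re]
  ring

/-- Traces of the resolvent of a Hermitian matrix and of its square, in terms of eigenvalues. -/
lemma Matrix.IsHermitian.trace_inv_sub_smul_one {X : Matrix n n ℂ} (hX : X.IsHermitian) (c : ℝ)
    (hc : ∀ j, hX.eigenvalues j ≠ c) :
    (X - (c : ℂ) • 1)⁻¹.trace = ∑ j, (((hX.eigenvalues j - c)⁻¹ : ℝ) : ℂ) ∧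
    ((X - (c : ℂ) • 1)⁻¹ * (X - (c : ℂ) • 1)⁻¹).trace =
      ∑ j, (((hX.eigenvalues j - c)⁻¹ ^ 2 : ℝ) : ℂ) := by
  set φ := Unitary.conjStarAlgAut ℂ _ hX.eigenvectorUnitary with hφ
  have htr (D : Matrix n n ℂ) : (φ D).trace = D.trace := by
    rw [hφ, Unitary.conjStarAlgAut_apply, trace_mul_cycle, Unitary.coe_star_mul_self,
      Matrix.one_mul]
  have hsub : X - (c : ℂ) • 1 = φ (diagonal fun j => ((hX.eigenvalues j - c : ℝ) : ℂ)) := by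
    have h1 : (diagonal fun j => ((hX.eigenvalues j - c : ℝ) : ℂ)) =
        diagonal (RCLike.ofReal ∘ hX.eigenvalues) - (c : ℂ) • (1 : Matrix n n ℂ) := by
      rw [smul_one_eq_diagonal, diagonal_sub]
      congr 1; ext j; simp
    rw [h1, map_sub, map_smul, map_one, ← hX.spectral_theorem]
  have hinv : (X - (c : ℂ) • 1)⁻¹ =
      φ (diagonal fun j => (((hX.eigenvalues j - c)⁻¹ : ℝ) : ℂ)) := by
    apply inv_eq_right_inv
    rw [hsub, ← map_mul, diagonal_mul_diagonal, ← map_one φ, ← diagonal_one]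
    congr 2; ext j
    rw [← Complex.ofReal_mul, mul_inv_cancel₀ (sub_ne_zero.2 (hc j)), Complex.ofReal_one]
  refine ⟨by rw [hinv, htr, trace_diagonal], ?_⟩
  rw [hinv, ← map_mul, htr, diagonal_mul_diagonal, trace_diagonal]
  simp [sq]

lemma barrier_sum_inequality {ι : Type*} (s : Finset ι) (μ : ι → ℝ) {ε : ℝ}
    (hμ : ∀ j ∈ s, 1 < μ j) (hε : ∑ j ∈ s, (μ j)⁻¹ ≤ ε) (hε1 : ε ≤ 1) :
    (1 - ε) * (∑ j ∈ s, (μ j - 1)⁻¹ - ∑ j ∈ s, (μ j)⁻¹) ≤ ∑ j ∈ s, (μ j - 1)⁻¹ ^ 2 -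
      (∑ j ∈ s, (μ j - 1)⁻¹ - ∑ j ∈ s, (μ j)⁻¹) * ∑ j ∈ s, (μ j - 1)⁻¹ := by
  have hD : ∑ j ∈ s, (μ j - 1)⁻¹ - ∑ j ∈ s, (μ j)⁻¹ = ∑ j ∈ s, (μ j)⁻¹ * (μ j - 1)⁻¹ := by
    rw [← Finset.sum_sub_distrib]
    refine Finset.sum_congr rfl fun j hj => ?_
    have := hμ j hj
    have h1 : μ j - 1 ≠ 0 := by linarith
    have h2 : μ j ≠ 0 := by linarith
    field_simp
    ring
  have hE : ∑ j ∈ s, (μ j - 1)⁻¹ ^ 2 - ∑ j ∈ s, (μ j)⁻¹ * (μ j - 1)⁻¹ =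
      ∑ j ∈ s, (μ j)⁻¹ * (μ j - 1)⁻¹ ^ 2 := by
    rw [← Finset.sum_sub_distrib]
    refine Finset.sum_congr rfl fun j hj => ?_
    have := hμ j hj
    have h1 : μ j - 1 ≠ 0 := by linarith
    have h2 : μ j ≠ 0 := by linarith
    field_simp
    ring
  have hx : ∀ j ∈ s, 0 ≤ (μ j)⁻¹ := fun j hj => inv_nonneg.2 (by linarith [hμ j hj])
  have hy : ∀ j ∈ s, 0 ≤ (μ j - 1)⁻¹ := fun j hj => inv_nonneg.2 (by linarith [hμ j hj])
  have hCS : (∑ j ∈ s, (μ j)⁻¹ * (μ j - 1)⁻¹) ^ 2 ≤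
      (∑ j ∈ s, (μ j)⁻¹) * ∑ j ∈ s, (μ j)⁻¹ * (μ j - 1)⁻¹ ^ 2 :=
    Finset.sum_sq_le_sum_mul_sum_of_sq_le_mul s hx
      (fun j hj => mul_nonneg (hx j hj) (sq_nonneg _)) fun j _ => le_of_eq (by ring)
  have hE0 : 0 ≤ ∑ j ∈ s, (μ j)⁻¹ * (μ j - 1)⁻¹ ^ 2 :=
    Finset.sum_nonneg fun j hj => mul_nonneg (hx j hj) (sq_nonneg _)
  have hD0 : 0 ≤ ∑ j ∈ s, (μ j)⁻¹ * (μ j - 1)⁻¹ :=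
    Finset.sum_nonneg fun j hj => mul_nonneg (hx j hj) (hy j hj)
  rw [hD]
  nlinarith [mul_nonneg hD0 (sub_nonneg.2 hε), mul_nonneg hE0 (sub_nonneg.2 (hε.trans hε1))]

/-- Moving the lower barrier by one keeps positive definiteness, and the total gain available from
an isotropic family is at least `1 - ε` times the increase of the potential. -/
lemma Matrix.PosDef.lower_barrier_shift {X : Matrix n n ℂ} (hX : X.PosDef) {ε : ℝ}
    (hε : X⁻¹.trace.re ≤ ε) (hε1 : ε < 1) :
    (X - 1).PosDef ∧ X⁻¹.trace.re ≤ (X - 1)⁻¹.trace.re ∧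
    (1 - ε) * ((X - 1)⁻¹.trace.re - X⁻¹.trace.re) ≤ ((X - 1)⁻¹ * (X - 1)⁻¹).trace.re -
      ((X - 1)⁻¹.trace.re - X⁻¹.trace.re) * (X - 1)⁻¹.trace.re := by
  set μ := hX.1.eigenvalues
  have hpos : ∀ j, 0 < μ j := hX.eigenvalues_pos
  have h0 : X⁻¹.trace.re = ∑ j, (μ j)⁻¹ := by
    have := (hX.1.trace_inv_sub_smul_one 0 fun j => (hpos j).ne').1
    simp only [Complex.ofReal_zero, zero_smul, sub_zero] at this
    rw [this, ← Complex.ofReal_sum, Complex.ofReal_re]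
  have hgt : ∀ j, 1 < μ j := fun j => by
    have h1 : (μ j)⁻¹ ≤ ∑ j, (μ j)⁻¹ :=
      Finset.single_le_sum (fun i _ => (inv_pos.2 (hpos i)).le) (Finset.mem_univ j)
    exact (inv_lt_one₀ (hpos j)).1 (by linarith)
  obtain ⟨h1, h2⟩ := hX.1.trace_inv_sub_smul_one 1 fun j => (hgt j).ne'
  simp only [Complex.ofReal_one, one_smul, ← Complex.ofReal_sum] at h1 h2
  rw [h0, h1, h2, Complex.ofReal_re, Complex.ofReal_re]
  refine ⟨?_, Finset.sum_le_sum fun j _ => ?_,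
    barrier_sum_inequality _ μ (fun j _ => hgt j) (h0 ▸ hε) hε1.le⟩
  · have hd : X - 1 = Unitary.conjStarAlgAut ℂ _ hX.1.eigenvectorUnitary
        (diagonal (RCLike.ofReal ∘ μ) - 1) := by
      rw [map_sub, map_one, ← hX.1.spectral_theorem]
    have hU : IsUnit (hX.1.eigenvectorUnitary : Matrix n n ℂ) :=
      (Unitary.toUnits hX.1.eigenvectorUnitary).isUnit
    rw [hd, Unitary.conjStarAlgAut_apply, hU.posDef_star_right_conjugate_iff, ← diagonal_one,
      diagonal_sub, posDef_diagonal_iff]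
    intro j
    have := hgt j
    simp only [Function.comp]
    rw [← Complex.ofReal_one]
    change (0 : ℂ) < ((μ j : ℝ) : ℂ) - _
    rw [← Complex.ofReal_sub]
    exact_mod_cast sub_pos.2 this
  · exact inv_anti₀ (by linarith [hgt j]) (by linarith)

/-- Moving the upper barrier of a diagonal matrix with gaps `g` by `δ`: adding `(U c)⁻¹` to the
entry `c` does not increase the potential. -/
lemma exists_upper_barrier_cost {κ : Type*} [Fintype κ] [DecidableEq κ] (g : κ → ℝ)
    (hg : ∀ c, 0 < g c) {η δ : ℝ} (hη : ∑ c, (g c)⁻¹ ≤ η) (hδ : 0 < δ) :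
    ∃ U : κ → ℝ, (∀ c, 0 < U c) ∧ ∑ c, U c ≤ δ⁻¹ + η ∧
      ∀ c, (∀ j, 0 < g j + δ - Pi.single (M := fun _ => ℝ) c (U c)⁻¹ j) ∧
        ∑ j, (g j + δ - Pi.single (M := fun _ => ℝ) c (U c)⁻¹ j)⁻¹ ≤ η := by
  rcases isEmpty_or_nonempty κ with hκ | hκ
  · refine ⟨0, fun c => isEmptyElim c, ?_, fun c => isEmptyElim c⟩
    simp only [Finset.univ_eq_empty, Finset.sum_empty] at hη ⊢
    positivity
  have hgδ : ∀ c, 0 < g c + δ := fun c => add_pos (hg c) hδ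
  have hy : ∀ c, 0 < (g c + δ)⁻¹ := fun c => inv_pos.2 (hgδ c)
  set D := ∑ c, (g c)⁻¹ - ∑ c, (g c + δ)⁻¹ with hD
  have hDge : δ * ∑ c, (g c + δ)⁻¹ ^ 2 ≤ D := by
    rw [hD, ← Finset.sum_sub_distrib, Finset.mul_sum]
    refine Finset.sum_le_sum fun c _ => ?_
    have h1 : (g c)⁻¹ - (g c + δ)⁻¹ = δ * ((g c)⁻¹ * (g c + δ)⁻¹) := by
      have := hg c
      have := hgδ c
      field_simp
      ring
    rw [h1, sq]
    have : (g c + δ)⁻¹ ≤ (g c)⁻¹ := inv_anti₀ (hg c) (by linarith)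
    have := (hy c).le
    gcongr
  have hS : 0 < ∑ c, (g c + δ)⁻¹ ^ 2 :=
    Finset.sum_pos (fun c _ => pow_pos (hy c) 2) Finset.univ_nonempty
  have hD0 : 0 < D := (mul_pos hδ hS).trans_le hDge
  have hU : ∀ c, 0 < (g c + δ)⁻¹ ^ 2 / D + (g c + δ)⁻¹ := fun c =>
    add_pos (div_pos (pow_pos (hy c) 2) hD0) (hy c)
  have key : ∀ c, g c + δ - ((g c + δ)⁻¹ ^ 2 / D + (g c + δ)⁻¹)⁻¹ = ((g c + δ)⁻¹ + D)⁻¹ := by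
    intro c
    have := hgδ c
    have h1 : 1 + D * (g c + δ) ≠ 0 := by positivity
    have h2 : (g c + δ)⁻¹ ^ 2 / D + (g c + δ)⁻¹ =
        (1 + D * (g c + δ)) / (D * (g c + δ) ^ 2) := by field_simp
    have h3 : (g c + δ)⁻¹ + D = (1 + D * (g c + δ)) / (g c + δ) := by field_simp
    rw [h2, h3, inv_div, inv_div]
    field_simp
    ring
  refine ⟨fun c => (g c + δ)⁻¹ ^ 2 / D + (g c + δ)⁻¹, hU, ?_, fun c => ⟨fun j => ?_, ?_⟩⟩
  · rw [Finset.sum_add_distrib, ← Finset.sum_div]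
    refine add_le_add ?_ (by linarith)
    rw [div_le_iff₀ hD0, inv_mul_eq_div, le_div_iff₀ hδ]
    linarith
  · rcases eq_or_ne j c with rfl | hj
    · rw [Pi.single_eq_same, key]
      exact inv_pos.2 (add_pos (hy j) hD0)
    · rw [Pi.single_eq_of_ne hj, sub_zero]
      exact hgδ j
  · have hterm : ∀ j, (g j + δ - Pi.single (M := fun _ => ℝ) c
        ((g c + δ)⁻¹ ^ 2 / D + (g c + δ)⁻¹)⁻¹ j)⁻¹ =
        (g j + δ)⁻¹ + Pi.single (M := fun _ => ℝ) c D j := by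
      intro j
      rcases eq_or_ne j c with rfl | hj
      · rw [Pi.single_eq_same, Pi.single_eq_same, key, inv_inv]
      · rw [Pi.single_eq_of_ne hj, Pi.single_eq_of_ne hj, sub_zero, add_zero]
    simp only [hterm, Finset.sum_add_distrib]
    rw [Finset.sum_pi_single']
    simp only [Finset.mem_univ, if_true]
    linarith

variable {ι κ : Type*} [Fintype ι] [Fintype κ] [DecidableEq κ]

/-- One step of the two-barrier argument: the lower barrier acts on a positive definite matrix, the
upper barrier on the total weights of the blocks of the partition given by `β`. -/
lemma exists_barrier_step [Nonempty ι] {v : ι → n → ℂ} (hv : ∑ i, rankOne (v i) = 1) {β : ι → κ}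
    {k : ℝ} (hk : 0 < k) (hβ : ∀ f : κ → ℝ, ∑ i, f (β i) = k * ∑ c, f c)
    {X : Matrix n n ℂ} (hX : X.PosDef) {g : κ → ℝ} (hg : ∀ c, 0 < g c) {ε η δ : ℝ}
    (hε : X⁻¹.trace.re ≤ ε) (hε1 : ε < 1) (hη : ∑ c, (g c)⁻¹ ≤ η) (hδ : 0 < δ)
    (h : δ⁻¹ + η ≤ 1 - ε) :
    ∃ (i : ι) (s : ℝ), 0 ≤ s ∧ (X - 1 + (s : ℂ) • rankOne (v i)).PosDef ∧
      (X - 1 + (s : ℂ) • rankOne (v i))⁻¹.trace.re ≤ ε ∧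
      (∀ c, 0 < g c + δ - Pi.single (M := fun _ => ℝ) (β i) (s / k) c) ∧
      ∑ c, (g c + δ - Pi.single (M := fun _ => ℝ) (β i) (s / k) c)⁻¹ ≤ η := by
  obtain ⟨U, hU, hUsum, hUstep⟩ := exists_upper_barrier_cost g hg hη hδ
  obtain ⟨hY, hmono, hgain⟩ := hX.lower_barrier_shift hε hε1
  set Y := X - 1
  set D := Y⁻¹.trace.re - X⁻¹.trace.re
  have hsum (R : Matrix n n ℂ) : ∑ i, (R * rankOne (v i)).trace.re = R.trace.re := by
    rw [← Complex.re_sum, ← trace_sum, ← Finset.mul_sum, hv, Matrix.mul_one]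
  have hD : 0 ≤ D := sub_nonneg.2 hmono
  have htotal : ∑ i, U (β i) / k * D ≤
      ∑ i, ((Y⁻¹ * Y⁻¹ * rankOne (v i)).trace.re - D * (Y⁻¹ * rankOne (v i)).trace.re) := by
    rw [Finset.sum_sub_distrib, ← Finset.mul_sum, hsum, hsum, ← Finset.sum_mul, ← Finset.sum_div,
      hβ, mul_div_cancel_left₀ _ hk.ne']
    exact (mul_le_mul_of_nonneg_right (hUsum.trans h) hD).trans hgain
  obtain ⟨i, -, hi⟩ := Finset.exists_le_of_sum_le Finset.univ_nonempty htotal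
  have hs : 0 < k / U (β i) := div_pos hk (hU _)
  have hq : 0 ≤ (Y⁻¹ * rankOne (v i)).trace.re :=
    (Complex.le_def.1 (hY.inv.posSemidef.trace_mul_rankOne_nonneg (v i))).1
  refine ⟨i, k / U (β i), hs.le, ?_, ?_, ?_⟩
  · exact hY.add_posSemidef ((posSemidef_vecMulVec_self_star (v i)).smul
      (by exact_mod_cast hs.le : (0 : ℂ) ≤ ((k / U (β i) : ℝ) : ℂ)))
  · rw [hY.trace_inv_add_smul_rankOne (v i) hs.le]
    set q := (Y⁻¹ * rankOne (v i)).trace.re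
    have hle : D ≤ k / U (β i) * (Y⁻¹ * Y⁻¹ * rankOne (v i)).trace.re / (1 + k / U (β i) * q) := by
      rw [le_div_iff₀ (by positivity)]
      have := mul_le_mul_of_nonneg_left hi hs.le
      have e : k / U (β i) * (U (β i) / k * D) = D := by
        have := hU (β i)
        field_simp
      rw [e] at this
      linarith
    linarith
  · have e : k / U (β i) / k = (U (β i))⁻¹ := by field_simp
    rw [e]
    exact hUstep (β i)

variable [DecidableEq ι]

/-- Iteration of the two-barrier step. -/
lemma exists_barrier_weights [Nonempty ι] {v : ι → n → ℂ} (hv : ∑ i, rankOne (v i) = 1) {β : ι → κ}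
    {k : ℝ} (hk : 0 < k) (hβ : ∀ f : κ → ℝ, ∑ i, f (β i) = k * ∑ c, f c)
    {X : Matrix n n ℂ} (hX : X.PosDef) {g : κ → ℝ} (hg : ∀ c, 0 < g c) {ε η δ : ℝ}
    (hε : X⁻¹.trace.re ≤ ε) (hε1 : ε < 1) (hη : ∑ c, (g c)⁻¹ ≤ η) (hδ : 0 < δ)
    (h : δ⁻¹ + η ≤ 1 - ε) (q : ℕ) :
    ∃ (J : Finset ι) (w : ι → ℝ), J.card ≤ q ∧ (∀ i, 0 ≤ w i) ∧ (∀ i ∉ J, w i = 0) ∧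
      (X - (q : ℂ) • 1 + ∑ i, (w i : ℂ) • rankOne (v i)).PosDef ∧
      (X - (q : ℂ) • 1 + ∑ i, (w i : ℂ) • rankOne (v i))⁻¹.trace.re ≤ ε ∧
      (∀ c, 0 < g c + q * δ - (∑ i with β i = c, w i) / k) ∧
      ∑ c, (g c + q * δ - (∑ i with β i = c, w i) / k)⁻¹ ≤ η := by
  induction q with
  | zero => exact ⟨∅, 0, by simpa using ⟨hX, hε, hg, hη⟩⟩
  | succ q ih =>
    obtain ⟨J, w, hJ, hw, hwJ, hX', hε', hg', hη'⟩ := ih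
    obtain ⟨i, s, hs, h1, h2, h3, h4⟩ := exists_barrier_step hv hk hβ hX' hg' hε' hε1 hη' hδ h
    have e1 : X - ((q + 1 : ℕ) : ℂ) • 1 + ∑ j, ((w + Pi.single i s : ι → ℝ) j : ℂ) • rankOne (v j) =
        X - (q : ℂ) • 1 + ∑ j, (w j : ℂ) • rankOne (v j) - 1 + (s : ℂ) • rankOne (v i) := by
      have : ∑ j, ((w + Pi.single i s : ι → ℝ) j : ℂ) • rankOne (v j) =
          ∑ j, (w j : ℂ) • rankOne (v j) + (s : ℂ) • rankOne (v i) := by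
        simp only [Pi.add_apply, Complex.ofReal_add, add_smul, Finset.sum_add_distrib]
        congr 1
        rw [Finset.sum_eq_single i (fun j _ hj => by simp [Pi.single_eq_of_ne hj]) (by simp)]
        simp
      rw [this]
      push_cast
      module
    have e2 : ∀ c, g c + (q + 1 : ℕ) * δ - (∑ j with β j = c, (w + Pi.single i s : ι → ℝ) j) / k =
        g c + q * δ - (∑ j with β j = c, w j) / k + δ -
          Pi.single (M := fun _ => ℝ) (β i) (s / k) c := by
      intro c
      have : (∑ j with β j = c, (Pi.single i s : ι → ℝ) j) / k =
          Pi.single (M := fun _ => ℝ) (β i) (s / k) c := by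
        rw [Finset.sum_pi_single']
        rcases eq_or_ne c (β i) with rfl | hc
        · simp
        · simp [hc.symm, hc]
      rw [← this]
      simp only [Pi.add_apply, Finset.sum_add_distrib]
      push_cast
      ring
    refine ⟨insert i J, w + Pi.single i s, (Finset.card_insert_le i J).trans (by omega), ?_, ?_, ?_⟩
    · exact fun j => add_nonneg (hw j) (by
        rcases eq_or_ne j i with rfl | hj
        · simpa using hs
        · simp [hj])
    · intro j hj
      rw [Finset.mem_insert, not_or] at hj
      simp [hwJ j hj.2, Pi.single_eq_of_ne hj.1]
    · simp only [e1, e2]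
      exact ⟨h1, h2, h3, h4⟩

lemma sq_add_one_div_sub_one_anti {x y : ℝ} (hx : 1 < x) (hxy : x ≤ y) :
    (y + 1) ^ 2 / (y - 1) ^ 2 ≤ (x + 1) ^ 2 / (x - 1) ^ 2 := by
  rw [← div_pow, ← div_pow]
  have hy : 0 < y - 1 := by linarith
  refine pow_le_pow_left₀ (div_nonneg (by linarith) hy.le) ?_ 2
  rw [div_le_div_iff₀ hy (by linarith)]
  nlinarith

/-- Unweighted subsampling of an isotropic family whose index set is partitioned into at most `N`
blocks of size `k`. -/
lemma exists_subset_of_isotropic [Nonempty ι] {v : ι → n → ℂ} (hv : ∑ i, rankOne (v i) = 1)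
    {β : ι → κ} {k : ℝ} (hk : 0 < k) (hβ : ∀ f : κ → ℝ, ∑ i, f (β i) = k * ∑ c, f c)
    {N : ℕ} (hN : 0 < N) (hn : Fintype.card n ≤ N) (hκ : Fintype.card κ ≤ N) {b : ℝ} (hb : 1 < b) :
    ∃ J : Finset ι, J.card ≤ ⌈b * N⌉₊ ∧ ∀ x : n → ℂ, ∑ i, ‖star (v i) ⬝ᵥ x‖ ^ 2 ≤
      k * ((√b + 1) ^ 2 / (√b - 1) ^ 2) * ∑ i ∈ J, ‖star (v i) ⬝ᵥ x‖ ^ 2 := by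
  have hN' : (0 : ℝ) < N := by exact_mod_cast hN
  set q := ⌈b * N⌉₊ with hq
  set r := √(q / N) with hr
  have hbq : b ≤ q / N := (le_div_iff₀ hN').2 (Nat.le_ceil _)
  have hqr : (q : ℝ) = r ^ 2 * N := by
    rw [hr, Real.sq_sqrt (by positivity), div_mul_cancel₀ _ hN'.ne']
  have hb1 : 1 < √b := by rwa [Real.lt_sqrt zero_le_one, one_pow]
  have hbr : √b ≤ r := Real.sqrt_le_sqrt hbq
  have hr1 : 0 < r - 1 := by linarith
  have hr0 : 0 < r := by linarith
  have hX : (((N * r : ℝ) : ℂ) • (1 : Matrix n n ℂ)).PosDef := PosDef.one.smul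
    (by exact_mod_cast mul_pos hN' hr0)
  have hε : (((N * r : ℝ) : ℂ) • (1 : Matrix n n ℂ))⁻¹.trace.re ≤ r⁻¹ := by
    have hinv : (((N * r : ℝ) : ℂ) • (1 : Matrix n n ℂ))⁻¹ = (((N * r)⁻¹ : ℝ) : ℂ) • 1 := by
      apply inv_eq_right_inv
      rw [Matrix.smul_mul, Matrix.one_mul, smul_smul, ← Complex.ofReal_mul,
        mul_inv_cancel₀ (by positivity), Complex.ofReal_one, one_smul]
    rw [hinv, trace_smul, trace_one, smul_eq_mul, Complex.re_ofReal_mul, Complex.natCast_re,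
      mul_inv, mul_right_comm, inv_mul_eq_div]
    exact mul_le_of_le_one_left (by positivity) ((div_le_one hN').2 (by exact_mod_cast hn))
  have hη : ∑ _c : κ, (N * (r * (r + 1) / (r - 1)))⁻¹ ≤ (r - 1) / (r * (r + 1)) := by
    rw [Finset.sum_const, Finset.card_univ, nsmul_eq_mul, mul_inv, inv_div, ← mul_assoc,
      ← div_eq_mul_inv]
    exact mul_le_of_le_one_left (by positivity) ((div_le_one hN').2 (by exact_mod_cast hκ))
  obtain ⟨J, w, hJ, hw, hwJ, hP, -, hg, -⟩ := exists_barrier_weights hv hk hβ hX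
    (g := fun _ => N * (r * (r + 1) / (r - 1))) (fun _ => by positivity) hε
    (inv_lt_one_of_one_lt₀ (by linarith)) hη (δ := (r + 1) / (r - 1)) (by positivity)
    (le_of_eq (by field_simp)) q
  refine ⟨J, hJ, fun x => ?_⟩
  have hsum : ∑ i, ‖star (v i) ⬝ᵥ x‖ ^ 2 = (star x ⬝ᵥ x).re := by
    have : star x ⬝ᵥ x = star x ⬝ᵥ ((∑ i, rankOne (v i)) *ᵥ x) := by rw [hv, one_mulVec]
    rw [this, sum_mulVec, dotProduct_sum]
    simp only [star_dotProduct_rankOne_mulVec]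
    rw [← Complex.ofReal_sum, Complex.ofReal_re]
  have hlow : N * (r * (r - 1)) * ∑ i, ‖star (v i) ⬝ᵥ x‖ ^ 2 ≤
      ∑ i, w i * ‖star (v i) ⬝ᵥ x‖ ^ 2 := by
    have h0 := (Complex.le_def.1 (hP.posSemidef.dotProduct_mulVec_nonneg x)).1
    rw [add_mulVec, sub_mulVec, sum_mulVec, dotProduct_add, dotProduct_sub, dotProduct_sum] at h0
    simp only [smul_mulVec, one_mulVec, dotProduct_smul, star_dotProduct_rankOne_mulVec,
      smul_eq_mul, ← Complex.ofReal_mul, ← Complex.ofReal_sum, Complex.add_re, Complex.sub_re,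
      Complex.ofReal_re, Complex.re_ofReal_mul, ← Complex.ofReal_natCast, Complex.zero_re,
      ← hsum] at h0
    rw [hqr] at h0
    linarith
  have hw_le : ∀ i, w i ≤ k * (N * (r * (r + 1) ^ 2 / (r - 1))) := fun i => by
    have h1 : w i ≤ ∑ j with β j = β i, w j :=
      Finset.single_le_sum (fun j _ => hw j) (by simp)
    have h2 := hg (β i)
    rw [sub_pos, div_lt_iff₀ hk, hqr] at h2
    have e : (N * (r * (r + 1) / (r - 1)) + r ^ 2 * N * ((r + 1) / (r - 1))) * k =
        k * (N * (r * (r + 1) ^ 2 / (r - 1))) := by ring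
    linarith
  have hup : ∑ i, w i * ‖star (v i) ⬝ᵥ x‖ ^ 2 ≤
      k * (N * (r * (r + 1) ^ 2 / (r - 1))) * ∑ i ∈ J, ‖star (v i) ⬝ᵥ x‖ ^ 2 := by
    rw [← Finset.sum_subset (Finset.subset_univ J) fun i _ hi => by rw [hwJ i hi, zero_mul],
      Finset.mul_sum]
    exact Finset.sum_le_sum fun i _ => mul_le_mul_of_nonneg_right (hw_le i) (by positivity)
  have hJ0 : 0 ≤ ∑ i ∈ J, ‖star (v i) ⬝ᵥ x‖ ^ 2 := Finset.sum_nonneg fun i _ => by positivity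
  have hmain : ∑ i, ‖star (v i) ⬝ᵥ x‖ ^ 2 ≤
      k * ((r + 1) ^ 2 / (r - 1) ^ 2) * ∑ i ∈ J, ‖star (v i) ⬝ᵥ x‖ ^ 2 := by
    refine le_of_mul_le_mul_left ((hlow.trans hup).trans_eq ?_)
      (by positivity : 0 < N * (r * (r - 1)))
    field_simp
  refine hmain.trans ?_
  gcongr ?_ * _
  exact mul_le_mul_of_nonneg_left (sq_add_one_div_sub_one_anti hb1 hbr) hk.le

end RankOne

/-- The sample vectors of a subspace of `ℂ^ι` in an orthonormal basis are isotropic. -/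
lemma exists_isotropic_of_submodule {ι : Type*} [Fintype ι]
    (W : Submodule ℂ (EuclideanSpace ℂ ι)) :
    ∃ v : ι → Fin (Module.finrank ℂ W) → ℂ, ∑ i, rankOne (v i) = 1 ∧
      ∀ w ∈ W, ∃ x, ∀ i, star (v i) ⬝ᵥ x = w i := by
  set e := stdOrthonormalBasis ℂ W
  refine ⟨fun i j => star ((e j : EuclideanSpace ℂ ι) i), ?_, fun w hw => ?_⟩
  · ext j j'
    have h := orthonormal_iff_ite.1 e.orthonormal j j'
    rw [Submodule.coe_inner, PiLp.inner_apply] at h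
    rw [Matrix.sum_apply, one_apply, ← h]
    refine Finset.sum_congr rfl fun i _ => ?_
    simp [vecMulVec_apply, mul_comm]
  · refine ⟨fun j => e.repr ⟨w, hw⟩ j, fun i => ?_⟩
    have h := congrArg (fun u : W => (u : EuclideanSpace ℂ ι) i) (e.sum_repr ⟨w, hw⟩)
    simp only [Submodule.coe_sum, Submodule.coe_smul, WithLp.ofLp_sum, Finset.sum_apply,
      WithLp.ofLp_smul, Pi.smul_apply, smul_eq_mul] at h
    rw [← h]
    refine Finset.sum_congr rfl fun j _ => ?_
    simp [mul_comm]

/-- Unweighted subsampling without norm assumptions (Theorem `thm:unweightes_bss`). -/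
theorem stmt_13 (m M : ℕ) (y : Fin M → Fin m → ℂ) (α : ℝ) (hα : 0 < α)
    (hdvd : ⌈α * m⌉₊ ∣ M) (b : ℝ) (hb : 1 < b) :
    ∃ J : Finset (Fin M), J.card ≤ ⌈b * (⌈(1 + α) * m⌉₊ : ℝ)⌉₊ ∧
      ∀ a : Fin m → ℂ,
        (1 / M) * ∑ i, ‖star (y i) ⬝ᵥ a‖ ^ 2 ≤
          2 / α * ((Real.sqrt b + 1) ^ 2 / (Real.sqrt b - 1) ^ 2) *
            ((1 / m) * ∑ i ∈ J, ‖star (y i) ⬝ᵥ a‖ ^ 2) := by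
  rcases Nat.eq_zero_or_pos m with rfl | hm
  · exact ⟨∅, by simp, fun a => by simp [dotProduct]⟩
  rcases Nat.eq_zero_or_pos M with rfl | hM
  · exact ⟨∅, by simp, fun a => by simp⟩
  have hm' : (0 : ℝ) < m := by exact_mod_cast hm
  obtain ⟨k, hMk⟩ := hdvd
  set p := ⌈α * m⌉₊ with hp
  subst hMk
  have hceil : ⌈(1 + α) * m⌉₊ = p + m := by
    rw [hp, ← Nat.ceil_add_natCast (by positivity)]
    ring_nf
  rw [hceil]
  have hk : 0 < k := Nat.pos_of_mul_pos_left hM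
  have hp0 : 0 < p := Nat.pos_of_mul_pos_right hM
  have : Nonempty (Fin (p * k)) := ⟨⟨0, hM⟩⟩
  let L : (Fin m → ℂ) →ₗ[ℂ] EuclideanSpace ℂ (Fin (p * k)) :=
    (WithLp.linearEquiv 2 ℂ (Fin (p * k) → ℂ)).symm.toLinearMap ∘ₗ
      Matrix.mulVecLin (Matrix.of fun i => star (y i))
  obtain ⟨v, hv, hW⟩ := exists_isotropic_of_submodule (LinearMap.range L)
  have hrank : Module.finrank ℂ (LinearMap.range L) ≤ m := by
    simpa using L.finrank_range_le
  obtain ⟨J, hJ, h⟩ := exists_subset_of_isotropic hv (k := k) (by exact_mod_cast hk)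
    (β := fun i => (finProdFinEquiv.symm i).1) (fun f => by
      rw [Equiv.sum_comp finProdFinEquiv.symm (fun z : Fin p × Fin k => f z.1),
        Fintype.sum_prod_type]
      simp [Finset.mul_sum])
    (N := p + m) (by omega) (by simp; omega) (by simp) hb
  refine ⟨J, hJ, fun a => ?_⟩
  obtain ⟨x, hx⟩ := hW (L a) ⟨a, rfl⟩
  have hxa : ∀ i, star (v i) ⬝ᵥ x = star (y i) ⬝ᵥ a := fun i => hx i
  have h' := h x
  simp only [hxa] at h'
  set c := (√b + 1) ^ 2 / (√b - 1) ^ 2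
  set S := ∑ i ∈ J, ‖star (y i) ⬝ᵥ a‖ ^ 2
  have hc : 0 ≤ c := by positivity
  have hS : 0 ≤ S := Finset.sum_nonneg fun i _ => by positivity
  have hαp : α * m ≤ p := Nat.le_ceil _
  have hk' : (0 : ℝ) < k := by exact_mod_cast hk
  have hp' : (0 : ℝ) < p := by exact_mod_cast hp0
  calc 1 / ((p * k : ℕ) : ℝ) * ∑ i, ‖star (y i) ⬝ᵥ a‖ ^ 2
      ≤ 1 / ((p * k : ℕ) : ℝ) * (k * c * S) := by gcongr
    _ = 1 / p * (c * S) := by push_cast; field_simp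
    _ ≤ 2 / (α * m) * (c * S) := by
      gcongr
      norm_num
    _ = 2 / α * c * (1 / m * S) := by field_simp
end

section
/- Let $y^1, \dots, y^M \in \mathbb{C}^m$ be any vectors with $m \ge 10$. Let $b' \ge 1 + \frac{10}{m}$ and assume $M \ge \lceil b' m \rceil$. Then there exists a subset $J' \subseteq \{1, \dots, M\}$ with $|J'| \le \lceil b' m \rceil$ such that for all $a \in \mathbb{C}^m$: $\frac{1}{M} \sum_{i=1}^M |\langle a, y^i \rangle|^2 \le \frac{432\, b'^3}{(b'-1)^3} \cdot \frac{1}{m} \sum_{i \in J'} |\langle a, y^i \rangle|^2$. -/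
open Matrix

/-- The matrix `∑ i ∈ J, v i (v i)ᴴ`. -/
noncomputable def frameMatrix {ι κ : Type*} (v : κ → ι → ℂ) (J : Finset κ) : Matrix ι ι ℂ :=
  ∑ i ∈ J, vecMulVec (v i) (star (v i))

/-- The lower barrier potential `tr (A - l)⁻¹`. -/
noncomputable def lowerPotential {ι : Type*} [Fintype ι] [DecidableEq ι]
    (A : Matrix ι ι ℂ) (l : ℝ) : ℝ :=
  (trace (A - (l : ℂ) • (1 : Matrix ι ι ℂ))⁻¹).re

section Scalar

variable {ι : Type*} [Fintype ι]

lemma sum_inv_sub_sum_inv_add {s : ι → ℝ} {δ : ℝ} (hs : ∀ i, 0 < s i) (hδ : 0 < δ) :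
    ∑ i, (s i)⁻¹ - ∑ i, (s i + δ)⁻¹ = δ * ∑ i, (s i)⁻¹ * (s i + δ)⁻¹ := by
  rw [← Finset.sum_sub_distrib, Finset.mul_sum]
  refine Finset.sum_congr rfl fun i _ => ?_
  have := hs i
  have : 0 < s i + δ := by linarith
  field_simp
  ring

/-- Shifting the barrier by `δ` leaves enough slack in the averaged update condition. -/
lemma shift_mul_le_sum_inv_sq {s : ι → ℝ} {δ : ℝ} (hs : ∀ i, 0 < s i) (hδ : 0 < δ)
    (hP : δ * ∑ i, (s i + δ)⁻¹ ≤ 1) :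
    (∑ i, (s i)⁻¹ - ∑ i, (s i + δ)⁻¹) * (1 / δ + (∑ i, (s i)⁻¹ - ∑ i, (s i + δ)⁻¹)) ≤
      ∑ i, ((s i)⁻¹) ^ 2 := by
  have hd : ∀ i, 0 < s i + δ := fun i => by linarith [hs i]
  rw [sum_inv_sub_sum_inv_add hs hδ]
  set X := ∑ i, (s i)⁻¹ * (s i + δ)⁻¹ with hX
  set Y := ∑ i, ((s i)⁻¹) ^ 2 * (s i + δ)⁻¹ with hY
  have hXY : ∑ i, ((s i)⁻¹) ^ 2 = X + δ * Y := by
    rw [hX, hY, Finset.mul_sum, ← Finset.sum_add_distrib]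
    refine Finset.sum_congr rfl fun i _ => ?_
    have := hs i
    have := hd i
    field_simp
  have hCS : X ^ 2 ≤ Y * ∑ i, (s i + δ)⁻¹ := by
    refine Finset.sum_sq_le_sum_mul_sum_of_sq_le_mul _ (fun i _ => ?_) (fun i _ => ?_)
      (fun i _ => le_of_eq (by ring))
    · have := hd i
      positivity
    · exact inv_nonneg.2 (hd i).le
  have hY0 : 0 ≤ Y := Finset.sum_nonneg fun i _ => by
    have := hd i
    positivity
  have h1 : δ * X ^ 2 ≤ Y := by
    calc δ * X ^ 2 ≤ δ * (Y * ∑ i, (s i + δ)⁻¹) := by gcongr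
      _ = Y * (δ * ∑ i, (s i + δ)⁻¹) := by ring
      _ ≤ Y * 1 := by gcongr
      _ = Y := mul_one _
  have h2 : δ * X * (1 / δ + δ * X) = X + δ * (δ * X ^ 2) := by
    field_simp
  rw [hXY, h2]
  gcongr

lemma shift_mul_sq_sum_inv_le {s : ι → ℝ} {δ : ℝ} (hs : ∀ i, 0 < s i) (hδ : 0 < δ) :
    δ * (∑ i, (s i + δ)⁻¹) ^ 2 ≤
      Fintype.card ι * (∑ i, (s i)⁻¹ - ∑ i, (s i + δ)⁻¹) := by
  rw [sum_inv_sub_sum_inv_add hs hδ, mul_left_comm]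
  gcongr
  refine (sq_sum_le_card_mul_sum_sq (s := Finset.univ)).trans ?_
  rw [Finset.card_univ]
  gcongr with i
  have := hs i
  rw [sq]
  gcongr
  linarith

/-- The combined scalar estimate behind the choice of the next vector. -/
lemma barrier_estimate [Nonempty ι] {s : ι → ℝ} {δ P l : ℝ} (hs : ∀ i, 0 < s i) (hδ : 0 < δ)
    (hPd : P = ∑ i, (s i + δ)⁻¹) (hP : δ * P ≤ 1) (hl : l ≤ 1) :
    (1 / δ - P) * (1 - l - Fintype.card ι / P) - 1 ≤
      ((1 - l) * ∑ i, ((s i)⁻¹) ^ 2 - ∑ i, (s i)⁻¹) / (∑ i, (s i)⁻¹ - P) +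
        (Fintype.card ι - (1 - l) * ∑ i, (s i)⁻¹) := by
  have hd : ∀ i, 0 < s i + δ := fun i => by linarith [hs i]
  have hP0 : 0 < P := hPd ▸ Finset.sum_pos (fun i _ => inv_pos.2 (hd i)) Finset.univ_nonempty
  have h1 := shift_mul_le_sum_inv_sq hs hδ (hPd ▸ hP)
  have h2 := shift_mul_sq_sum_inv_le hs hδ
  rw [← hPd] at h1 h2
  set P' := ∑ i, (s i)⁻¹
  set Q := ∑ i, ((s i)⁻¹) ^ 2
  set r : ℝ := (Fintype.card ι : ℝ) with hr
  have hr0 : 0 < r := by rw [hr]; exact_mod_cast Fintype.card_pos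
  have hΔ : 0 < P' - P := by
    by_contra h
    have : 0 < δ * P ^ 2 := by positivity
    nlinarith
  have h3 : 1 / δ + (P' - P) ≤ Q / (P' - P) := by
    rw [le_div_iff₀ hΔ]; linarith
  have h4 : P / (P' - P) ≤ r / (δ * P) := by
    rw [div_le_div_iff₀ hΔ (by positivity)]; linarith
  have h5 : ((1 - l) * Q - P') / (P' - P) = (1 - l) * (Q / (P' - P)) - 1 - P / (P' - P) := by
    field_simp
    ring
  have h6 : (1 / δ - P) * (1 - l - r / P) = (1 - l) * (1 / δ - P) - r / (δ * P) + r := by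
    field_simp
    ring
  rw [h5, h6]
  have h7 := mul_le_mul_of_nonneg_left h3 (sub_nonneg.2 hl)
  linarith

/-- A barrier below all `x i` can be raised until its potential equals a prescribed value. -/
lemma exists_barrier_eq [Nonempty ι] {x : ι → ℝ} {l P : ℝ} (hx : ∀ i, l < x i)
    (hP : ∑ i, (x i - l)⁻¹ ≤ P) :
    ∃ l', l ≤ l' ∧ (∀ i, l' < x i) ∧ ∑ i, (x i - l')⁻¹ = P := by
  obtain ⟨j, hj⟩ := Finite.exists_min x
  have hterm : ∀ u, (∀ i, u < x i) → (x j - u)⁻¹ ≤ ∑ i, (x i - u)⁻¹ := fun u hu =>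
    Finset.single_le_sum (f := fun i => (x i - u)⁻¹)
      (fun i _ => inv_nonneg.2 (sub_nonneg.2 (hu i).le)) (Finset.mem_univ j)
  have hj0 : 0 < x j - l := sub_pos.2 (hx j)
  have h1 : (x j - l)⁻¹ ≤ P := (hterm l hx).trans hP
  have hP0 : 0 < P := (inv_pos.2 hj0).trans_le h1
  have h2 : P⁻¹ ≤ x j - l := inv_le_of_inv_le₀ hj0 h1
  have hlt : ∀ u ≤ x j - P⁻¹, ∀ i, u < x i := fun u hu i => by
    have := hj i
    have := inv_pos.2 hP0
    linarith
  have hcont : ContinuousOn (fun u => ∑ i, (x i - u)⁻¹) (Set.Icc l (x j - P⁻¹)) := by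
    refine continuousOn_finsetSum _ fun i _ => ?_
    refine ContinuousOn.inv₀ (by fun_prop) fun u hu => ?_
    exact (sub_pos.2 (hlt u hu.2 i)).ne'
  have hmem : P ∈ Set.Icc (∑ i, (x i - l)⁻¹) (∑ i, (x i - (x j - P⁻¹))⁻¹) := by
    refine ⟨hP, ?_⟩
    have := hterm _ (hlt _ le_rfl)
    simpa using this
  obtain ⟨u, hu, hu'⟩ := intermediate_value_Icc (by linarith) hcont hmem
  exact ⟨u, hu.1, hlt u hu.2, hu'⟩

end Scalar

section Spectral

open scoped ComplexOrder

variable {ι : Type*} [Fintype ι] [DecidableEq ι] {A : Matrix ι ι ℂ}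

lemma Matrix.IsHermitian.sub_smul_one_eq (hA : A.IsHermitian) (l : ℝ) :
    A - (l : ℂ) • (1 : Matrix ι ι ℂ) =
      (hA.eigenvectorUnitary : Matrix ι ι ℂ) *
        diagonal (fun i => ((hA.eigenvalues i - l : ℝ) : ℂ)) *
        star (hA.eigenvectorUnitary : Matrix ι ι ℂ) := by
  have h : diagonal (fun i => ((hA.eigenvalues i - l : ℝ) : ℂ)) =
      diagonal (RCLike.ofReal ∘ hA.eigenvalues) - (l : ℂ) • (1 : Matrix ι ι ℂ) := by
    ext i j
    by_cases hij : i = j <;> simp [diagonal, hij]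
  conv_lhs => rw [hA.spectral_theorem, Unitary.conjStarAlgAut_apply]
  rw [h, mul_sub, sub_mul]
  simp

lemma Matrix.IsHermitian.sub_smul_one_inv_eq (hA : A.IsHermitian) {l : ℝ}
    (hl : ∀ i, l < hA.eigenvalues i) :
    (A - (l : ℂ) • (1 : Matrix ι ι ℂ))⁻¹ =
      (hA.eigenvectorUnitary : Matrix ι ι ℂ) *
        diagonal (fun i => (((hA.eigenvalues i - l)⁻¹ : ℝ) : ℂ)) *
        star (hA.eigenvectorUnitary : Matrix ι ι ℂ) := by
  refine inv_eq_right_inv ?_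
  rw [hA.sub_smul_one_eq]
  set U : Matrix ι ι ℂ := (hA.eigenvectorUnitary : Matrix ι ι ℂ)
  have hU : star U * U = 1 := Unitary.coe_star_mul_self _
  have hU' : U * star U = 1 := Unitary.coe_mul_star_self _
  have hD : diagonal (fun i => ((hA.eigenvalues i - l : ℝ) : ℂ)) *
      diagonal (fun i => (((hA.eigenvalues i - l)⁻¹ : ℝ) : ℂ)) = 1 := by
    rw [diagonal_mul_diagonal, ← diagonal_one]
    congr 1
    funext i
    rw [← Complex.ofReal_mul, mul_inv_cancel₀ (sub_pos.2 (hl i)).ne', Complex.ofReal_one]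
  calc _ = U * diagonal (fun i => ((hA.eigenvalues i - l : ℝ) : ℂ)) * (star U * U) *
        diagonal (fun i => (((hA.eigenvalues i - l)⁻¹ : ℝ) : ℂ)) * star U := by
        simp only [mul_assoc]
    _ = 1 := by rw [hU, mul_one, mul_assoc U, hD, mul_one, hU']

lemma Matrix.IsHermitian.posDef_sub_smul_one_iff (hA : A.IsHermitian) (l : ℝ) :
    (A - (l : ℂ) • (1 : Matrix ι ι ℂ)).PosDef ↔ ∀ i, l < hA.eigenvalues i := by
  rw [hA.sub_smul_one_eq, (Unitary.isUnit_coe).posDef_star_right_conjugate_iff,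
    posDef_diagonal_iff]
  simp only [Complex.zero_lt_real, sub_pos]

lemma Matrix.IsHermitian.lowerPotential_eq (hA : A.IsHermitian) {l : ℝ}
    (hl : ∀ i, l < hA.eigenvalues i) :
    lowerPotential A l = ∑ i, (hA.eigenvalues i - l)⁻¹ := by
  rw [lowerPotential, hA.sub_smul_one_inv_eq hl, trace_mul_cycle, Unitary.coe_star_mul_self,
    one_mul, trace_diagonal, ← Complex.ofReal_sum, Complex.ofReal_re]

lemma Matrix.IsHermitian.trace_inv_mul_inv_eq (hA : A.IsHermitian) {l : ℝ}
    (hl : ∀ i, l < hA.eigenvalues i) :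
    (trace ((A - (l : ℂ) • (1 : Matrix ι ι ℂ))⁻¹ * (A - (l : ℂ) • (1 : Matrix ι ι ℂ))⁻¹)).re =
      ∑ i, ((hA.eigenvalues i - l)⁻¹) ^ 2 := by
  rw [hA.sub_smul_one_inv_eq hl]
  set U : Matrix ι ι ℂ := (hA.eigenvectorUnitary : Matrix ι ι ℂ)
  set D : Matrix ι ι ℂ := diagonal (fun i => (((hA.eigenvalues i - l)⁻¹ : ℝ) : ℂ)) with hD
  have hU : star U * U = 1 := Unitary.coe_star_mul_self _
  have h : U * D * star U * (U * D * star U) = U * (D * D) * star U := by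
    calc _ = U * D * (star U * U) * D * star U := by simp only [mul_assoc]
      _ = _ := by rw [hU]; simp only [mul_assoc, one_mul]
  rw [h, trace_mul_cycle, hU, one_mul, hD, diagonal_mul_diagonal, trace_diagonal]
  simp only [← Complex.ofReal_mul]
  rw [← Complex.ofReal_sum, Complex.ofReal_re]
  simp only [sq]

end Spectral

section Frame

open scoped ComplexOrder

variable {ι κ : Type*} [Fintype ι]

lemma sum_dotProduct_mulVec_eq_trace (v : κ → ι → ℂ) (J : Finset κ) (R : Matrix ι ι ℂ) :
    ∑ i ∈ J, star (v i) ⬝ᵥ (R *ᵥ v i) = trace (R * frameMatrix v J) := by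
  rw [frameMatrix, Finset.mul_sum, trace_sum]
  refine Finset.sum_congr rfl fun i _ => ?_
  rw [mul_vecMulVec, trace_vecMulVec, dotProduct_comm]

lemma isHermitian_frameMatrix (v : κ → ι → ℂ) (J : Finset κ) : (frameMatrix v J).IsHermitian :=
  (posSemidef_sum J fun i _ => posSemidef_vecMulVec_self_star (v i)).isHermitian

lemma re_dotProduct_frameMatrix_mulVec (v : κ → ι → ℂ) (J : Finset κ) (c : ι → ℂ) :
    (star c ⬝ᵥ (frameMatrix v J *ᵥ c)).re = ∑ i ∈ J, ‖star (v i) ⬝ᵥ c‖ ^ 2 := by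
  rw [frameMatrix, sum_mulVec, dotProduct_sum, Complex.re_sum]
  refine Finset.sum_congr rfl fun i _ => ?_
  have h : star c ⬝ᵥ v i = star (star (v i) ⬝ᵥ c) := by
    rw [star_dotProduct]
  rw [vecMulVec_mulVec, op_smul_eq_smul, dotProduct_smul, h, smul_eq_mul, Complex.star_def,
    Complex.mul_conj, Complex.ofReal_re, Complex.normSq_eq_norm_sq]

end Frame

section Update

open scoped ComplexOrder

variable {ι κ : Type*} [Fintype ι] [DecidableEq ι]

/-- The Sherman–Morrison formula. -/
lemma Matrix.inv_add_vecMulVec {S : Matrix ι ι ℂ} (hS : IsUnit S) (u w : ι → ℂ)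
    (h : 1 + w ⬝ᵥ (S⁻¹ *ᵥ u) ≠ 0) :
    (S + vecMulVec u w)⁻¹ =
      S⁻¹ - (1 + w ⬝ᵥ (S⁻¹ *ᵥ u))⁻¹ • vecMulVec (S⁻¹ *ᵥ u) (w ᵥ* S⁻¹) := by
  refine inv_eq_right_inv ?_
  have hS' : S * S⁻¹ = 1 := mul_nonsing_inv S ((isUnit_iff_isUnit_det S).1 hS)
  set q := w ⬝ᵥ (S⁻¹ *ᵥ u) with hq
  have h1 : S * vecMulVec (S⁻¹ *ᵥ u) (w ᵥ* S⁻¹) = vecMulVec u (w ᵥ* S⁻¹) := by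
    rw [mul_vecMulVec, mulVec_mulVec, hS', one_mulVec]
  have h2 : vecMulVec u w * vecMulVec (S⁻¹ *ᵥ u) (w ᵥ* S⁻¹) = q • vecMulVec u (w ᵥ* S⁻¹) := by
    rw [vecMulVec_mul_vecMulVec]
    ext i j
    simp [vecMulVec_apply, hq]
    ring
  rw [add_mul, mul_sub, mul_sub, hS', mul_smul_comm, mul_smul_comm, h1, h2, vecMulVec_mul,
    smul_smul]
  have h3 : vecMulVec u (w ᵥ* S⁻¹) =
      (1 + q)⁻¹ • vecMulVec u (w ᵥ* S⁻¹) + ((1 + q)⁻¹ * q) • vecMulVec u (w ᵥ* S⁻¹) := by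
    rw [← add_smul, ← mul_one_add, inv_mul_cancel₀ h, one_smul]
  nth_rewrite 2 [h3]
  abel

lemma Matrix.PosDef.re_trace_inv_add_vecMulVec {S : Matrix ι ι ℂ} (hS : S.PosDef) (u : ι → ℂ) :
    (trace (S + vecMulVec u (star u))⁻¹).re =
      (trace S⁻¹).re - (star u ⬝ᵥ ((S⁻¹ * S⁻¹) *ᵥ u)).re / (1 + (star u ⬝ᵥ (S⁻¹ *ᵥ u)).re) := by
  have hq := hS.inv.posSemidef.dotProduct_mulVec_nonneg u
  obtain ⟨q, hq0, hq'⟩ : ∃ q : ℝ, 0 ≤ q ∧ star u ⬝ᵥ (S⁻¹ *ᵥ u) = q := by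
    obtain ⟨h1, h2⟩ := Complex.nonneg_iff.1 hq
    exact ⟨_, h1, Complex.ext rfl h2.symm⟩
  have hne : (1 : ℂ) + q ≠ 0 := by
    rw [← Complex.ofReal_one, ← Complex.ofReal_add, Complex.ofReal_ne_zero]
    positivity
  rw [inv_add_vecMulVec hS.isUnit _ _ (by rwa [hq']), hq', trace_sub, trace_smul,
    trace_vecMulVec, dotProduct_comm, ← dotProduct_mulVec, mulVec_mulVec, Complex.sub_re,
    Complex.ofReal_re, ← Complex.ofReal_one, ← Complex.ofReal_add, ← Complex.ofReal_inv,
    smul_eq_mul, Complex.re_ofReal_mul]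
  ring

/-- As long as the barrier is not too high, some unused vector allows to shift it by `δ` without
increasing the potential. -/
lemma exists_insert_lowerPotential_le [Nonempty ι] [Fintype κ] [DecidableEq κ] {v : κ → ι → ℂ}
    (hv : frameMatrix v Finset.univ = 1) {J : Finset κ} {l δ P : ℝ}
    (hpos : (frameMatrix v J - (l : ℂ) • (1 : Matrix ι ι ℂ)).PosDef)
    (hP : lowerPotential (frameMatrix v J) l = P) (hδ : 0 < δ) (hδP : δ * P < 1)
    (hl : l + δ ≤ 1)
    (hsum : Fintype.card κ < (1 / δ - P) * (1 - (l + δ) - Fintype.card ι / P) - 1) :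
    ∃ i ∉ J, (frameMatrix v (insert i J) - ((l + δ : ℝ) : ℂ) • (1 : Matrix ι ι ℂ)).PosDef ∧
      lowerPotential (frameMatrix v (insert i J)) (l + δ) ≤ P := by
  set A := frameMatrix v J with hAdef
  have hA : A.IsHermitian := isHermitian_frameMatrix v J
  have hlam := (hA.posDef_sub_smul_one_iff l).1 hpos
  rw [hA.lowerPotential_eq hlam] at hP
  have hs : ∀ i, l + δ < hA.eigenvalues i := fun i => by
    have h0 : 0 < hA.eigenvalues i - l := sub_pos.2 (hlam i)
    have h1 : (hA.eigenvalues i - l)⁻¹ ≤ P := hP ▸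
      Finset.single_le_sum (f := fun i => (hA.eigenvalues i - l)⁻¹)
        (fun j _ => inv_nonneg.2 (sub_pos.2 (hlam j)).le) (Finset.mem_univ i)
    have h2 : δ * (hA.eigenvalues i - l)⁻¹ < 1 :=
      (mul_le_mul_of_nonneg_left h1 hδ.le).trans_lt hδP
    rw [← div_eq_mul_inv, div_lt_one h0] at h2
    linarith
  have hS : (A - ((l + δ : ℝ) : ℂ) • (1 : Matrix ι ι ℂ)).PosDef :=
    (hA.posDef_sub_smul_one_iff _).2 hs
  have hest := barrier_estimate (s := fun i => hA.eigenvalues i - (l + δ)) (P := P) (l := l + δ)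
    (fun i => sub_pos.2 (hs i)) hδ (by rw [← hP]; congr 1; funext i; ring_nf) hδP.le hl
  have hΔ : 0 < ∑ i, (hA.eigenvalues i - (l + δ))⁻¹ - P := by
    rw [← hP, sub_pos]
    refine Finset.sum_lt_sum_of_nonempty Finset.univ_nonempty fun i _ => ?_
    have := hs i
    gcongr
    linarith
  have hP' := hA.lowerPotential_eq hs
  have hQ := hA.trace_inv_mul_inv_eq hs
  rw [lowerPotential] at hP'
  rw [← hP', ← hQ] at hest
  rw [← hP'] at hΔ
  set S := A - ((l + δ : ℝ) : ℂ) • (1 : Matrix ι ι ℂ) with hSdef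
  set P' := (trace S⁻¹).re
  set Q := (trace (S⁻¹ * S⁻¹)).re
  have hRS : S⁻¹ * S = 1 := nonsing_inv_mul S ((isUnit_iff_isUnit_det S).1 hS.isUnit)
  have hRA : S⁻¹ * A = 1 + ((l + δ : ℝ) : ℂ) • S⁻¹ := by
    have : A = S + ((l + δ : ℝ) : ℂ) • (1 : Matrix ι ι ℂ) := by rw [hSdef]; abel
    rw [this, mul_add, hRS, mul_smul_comm, mul_one]
  have hcompl : frameMatrix v Jᶜ = 1 - A := by
    rw [← hv, hAdef, frameMatrix, frameMatrix, frameMatrix, eq_sub_iff_add_eq,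
      Finset.sum_compl_add_sum]
  have hsum1 : ∑ i ∈ Jᶜ, (star (v i) ⬝ᵥ (S⁻¹ *ᵥ v i)).re =
      (1 - (l + δ)) * P' - Fintype.card ι := by
    rw [← Complex.re_sum, sum_dotProduct_mulVec_eq_trace, hcompl, mul_sub, mul_one, hRA, trace_sub,
      trace_add, trace_one, trace_smul, Complex.sub_re, Complex.add_re, Complex.natCast_re,
      smul_eq_mul, Complex.re_ofReal_mul]
    ring
  have hsum2 : ∑ i ∈ Jᶜ, (star (v i) ⬝ᵥ ((S⁻¹ * S⁻¹) *ᵥ v i)).re =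
      (1 - (l + δ)) * Q - P' := by
    rw [← Complex.re_sum, sum_dotProduct_mulVec_eq_trace, hcompl, mul_sub, mul_one, mul_assoc _ _ A,
      hRA, mul_add, mul_one, mul_smul_comm, trace_sub, trace_add, trace_smul, Complex.sub_re,
      Complex.add_re, smul_eq_mul, Complex.re_ofReal_mul]
    ring
  obtain ⟨i, hi, hLi⟩ : ∃ i ∈ Jᶜ, 1 ≤ (star (v i) ⬝ᵥ ((S⁻¹ * S⁻¹) *ᵥ v i)).re / (P' - P) -
      (star (v i) ⬝ᵥ (S⁻¹ *ᵥ v i)).re := by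
    by_contra! h
    have h1 := Finset.sum_le_sum fun i hi => (h i hi).le
    rw [Finset.sum_sub_distrib, ← Finset.sum_div, hsum1, hsum2, Finset.sum_const, nsmul_eq_mul,
      mul_one] at h1
    have h2 : ((Jᶜ.card : ℕ) : ℝ) ≤ Fintype.card κ := by exact_mod_cast Finset.card_le_univ _
    linarith
  have hiJ : i ∉ J := Finset.mem_compl.1 hi
  have hins : frameMatrix v (insert i J) - ((l + δ : ℝ) : ℂ) • (1 : Matrix ι ι ℂ) =
      S + vecMulVec (v i) (star (v i)) := by
    rw [frameMatrix, Finset.sum_insert hiJ, hSdef, hAdef, frameMatrix]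
    abel
  refine ⟨i, hiJ, ?_, ?_⟩
  · rw [hins]
    exact hS.add_posSemidef (posSemidef_vecMulVec_self_star (v i))
  · rw [lowerPotential, hins, hS.re_trace_inv_add_vecMulVec]
    have hq : 0 ≤ (star (v i) ⬝ᵥ (S⁻¹ *ᵥ v i)).re :=
      (Complex.nonneg_iff.1 (hS.inv.posSemidef.dotProduct_mulVec_nonneg (v i))).1
    have h1 : P' - P ≤ (star (v i) ⬝ᵥ ((S⁻¹ * S⁻¹) *ᵥ v i)).re /
        (1 + (star (v i) ⬝ᵥ (S⁻¹ *ᵥ v i)).re) := by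
      rw [le_div_iff₀ (by linarith), mul_comm, ← le_div_iff₀ hΔ]
      linarith
    linarith

end Update

section Selection

open scoped ComplexOrder

variable {ι κ : Type*} [Fintype ι] [DecidableEq ι]

lemma exists_posDef_lowerPotential_eq [Nonempty ι] {A : Matrix ι ι ℂ} (hA : A.IsHermitian)
    {l P : ℝ} (hpos : (A - (l : ℂ) • (1 : Matrix ι ι ℂ)).PosDef) (hP : lowerPotential A l ≤ P) :
    ∃ l', l ≤ l' ∧ (A - (l' : ℂ) • (1 : Matrix ι ι ℂ)).PosDef ∧ lowerPotential A l' = P := by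
  have hlam := (hA.posDef_sub_smul_one_iff l).1 hpos
  rw [hA.lowerPotential_eq hlam] at hP
  obtain ⟨l', h1, h2, h3⟩ := exists_barrier_eq hlam hP
  exact ⟨l', h1, (hA.posDef_sub_smul_one_iff l').2 h2, by rw [hA.lowerPotential_eq h2, h3]⟩

/-- Iterating the barrier shift until the barrier reaches the level `L`. -/
lemma exists_card_le_posDef_of_barrier [Nonempty ι] [Fintype κ] [DecidableEq κ] {v : κ → ι → ℂ}
    (hv : frameMatrix v Finset.univ = 1) {L δ P : ℝ} (hP : 0 < P) (hδ : 0 < δ) (hδP : δ * P < 1)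
    (hL : L + δ ≤ 1)
    (hsum : Fintype.card κ < (1 / δ - P) * (1 - (L + δ) - Fintype.card ι / P) - 1) (n : ℕ) :
    ∃ J : Finset κ, J.card ≤ n ∧ ∃ l : ℝ, min L (n * δ - Fintype.card ι / P) ≤ l ∧
      (frameMatrix v J - (l : ℂ) • (1 : Matrix ι ι ℂ)).PosDef ∧
      lowerPotential (frameMatrix v J) l = P := by
  induction n with
  | zero =>
    have hr : (0 : ℝ) < Fintype.card ι := by exact_mod_cast Fintype.card_pos
    have hr0 : (0 : ℝ) < Fintype.card ι / P := by positivity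
    have h0 : frameMatrix v ∅ - ((-(Fintype.card ι / P) : ℝ) : ℂ) • (1 : Matrix ι ι ℂ) =
        ((Fintype.card ι / P : ℝ) : ℂ) • (1 : Matrix ι ι ℂ) := by
      simp [frameMatrix]
    refine ⟨∅, by simp, -(Fintype.card ι / P), by simp, ?_, ?_⟩
    · rw [h0]
      exact PosDef.one.smul (Complex.zero_lt_real.2 hr0)
    · have hinv : (((Fintype.card ι / P : ℝ) : ℂ) • (1 : Matrix ι ι ℂ))⁻¹ =
          (((Fintype.card ι / P)⁻¹ : ℝ) : ℂ) • (1 : Matrix ι ι ℂ) := by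
        refine inv_eq_right_inv ?_
        rw [smul_mul_smul_comm, mul_one, ← Complex.ofReal_mul, mul_inv_cancel₀ hr0.ne',
          Complex.ofReal_one, one_smul]
      rw [lowerPotential, h0, hinv, trace_smul, trace_one, smul_eq_mul, Complex.re_ofReal_mul,
        Complex.natCast_re]
      field_simp
  | succ n ih =>
    obtain ⟨J, hJ, l, hl, hpos, hlP⟩ := ih
    by_cases hLl : L ≤ l
    · exact ⟨J, hJ.trans n.le_succ, l, (min_le_left _ _).trans hLl, hpos, hlP⟩
    push Not at hLl
    have hmul : 0 < 1 / δ - P := by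
      rw [sub_pos, lt_div_iff₀ hδ]; linarith
    have hsum' : Fintype.card κ < (1 / δ - P) * (1 - (l + δ) - Fintype.card ι / P) - 1 :=
      hsum.trans_le (by gcongr)
    obtain ⟨i, hi, hpos', hP'⟩ := exists_insert_lowerPotential_le hv hpos hlP hδ hδP
      (by linarith) hsum'
    obtain ⟨l', hl', hpos'', hP''⟩ :=
      exists_posDef_lowerPotential_eq (isHermitian_frameMatrix v _) hpos' hP'
    refine ⟨insert i J, ?_, l', ?_, hpos'', hP''⟩
    · rw [Finset.card_insert_of_notMem hi]; lia
    · have h1 : n * δ - Fintype.card ι / P ≤ l := by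
        rcases min_le_iff.1 hl with h | h
        · linarith
        · exact h
      refine (min_le_right _ _).trans ?_
      push_cast
      linarith

/-- Quantitative subset selection for a Parseval frame. -/
lemma exists_card_le_posSemidef [Fintype κ] [DecidableEq κ] {v : κ → ι → ℂ}
    (hv : frameMatrix v Finset.univ = 1) {m n : ℕ} (hm : 10 ≤ m) (hιm : Fintype.card ι ≤ m)
    {ε : ℝ} (hε : 0 < ε) (hε1 : ε ≤ 1) (hn : (1 + ε) * m ≤ n) (hnM : n ≤ Fintype.card κ) :
    ∃ J : Finset κ, J.card ≤ n ∧
      (frameMatrix v J -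
        ((m / Fintype.card κ * (ε ^ 2 / 12) : ℝ) : ℂ) • (1 : Matrix ι ι ℂ)).PosSemidef := by
  rcases isEmpty_or_nonempty ι with hι | hι
  · exact ⟨∅, by simp, by rw [Subsingleton.elim (_ - _) (0 : Matrix ι ι ℂ)]; exact .zero⟩
  set M : ℝ := (Fintype.card κ : ℝ) with hMdef
  have hmR : (10 : ℝ) ≤ m := by exact_mod_cast hm
  have hnMR : (n : ℝ) ≤ M := Nat.cast_le.2 hnM
  have hιmR : (Fintype.card ι : ℝ) ≤ m := by exact_mod_cast hιm
  have hmM : (m : ℝ) ≤ M := by nlinarith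
  have hM0 : 0 < M := by linarith
  have hμ : (m : ℝ) / M ≤ 1 := (div_le_one hM0).2 hmM
  have hμ0 : 0 ≤ (m : ℝ) / M := by positivity
  set P : ℝ := 4 * M / ε with hPdef
  set δ : ℝ := 1 / (P + 2 * M) with hδdef
  have hP : 0 < P := by positivity
  have hδ : 0 < δ := by positivity
  have hδP : δ * P < 1 := by
    rw [hδdef, one_div, inv_mul_eq_div, div_lt_one (by positivity)]
    linarith
  have hP4 : 4 * M ≤ P := by
    rw [hPdef, le_div_iff₀ hε]; nlinarith
  have hδ' : δ ≤ 1 / 60 := by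
    rw [hδdef]
    exact one_div_le_one_div_of_le (by norm_num) (by linarith)
  have hL : (m : ℝ) / M * (ε ^ 2 / 12) ≤ 1 / 12 := by
    have : ε ^ 2 ≤ 1 := by nlinarith
    nlinarith
  have hιP : Fintype.card ι / P ≤ 1 / 4 := by
    rw [div_le_iff₀ hP]; linarith
  have hsum : M < (1 / δ - P) * (1 - (m / M * (ε ^ 2 / 12) + δ) - Fintype.card ι / P) - 1 := by
    have h1 : 1 / δ - P = 2 * M := by rw [hδdef, one_div_one_div]; ring
    rw [h1]
    nlinarith
  obtain ⟨J, hJ, l, hl, hpos, -⟩ := exists_card_le_posDef_of_barrier hv hP hδ hδP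
    (by linarith) hsum n
  refine ⟨J, hJ, ?_⟩
  have hfin : (m : ℝ) / M * (ε ^ 2 / 12) ≤ n * δ - Fintype.card ι / P := by
    have h1 : (Fintype.card ι : ℝ) / P ≤ m / M * (ε / 4) := by
      calc (Fintype.card ι : ℝ) / P ≤ m / P := by gcongr
        _ = m / M * (ε / 4) := by rw [hPdef]; field_simp
    have h2 : (1 + ε) * m * δ ≤ n * δ := by gcongr
    have h3 : (1 + ε) * m * δ = m / M * (ε * (1 + ε) / (4 + 2 * ε)) := by
      rw [hδdef, hPdef]; field_simp
    have h4 : ε ^ 2 / 12 + ε / 4 ≤ ε * (1 + ε) / (4 + 2 * ε) := by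
      rw [le_div_iff₀ (by positivity)]
      nlinarith [mul_pos hε hε, mul_nonneg (mul_pos hε hε).le (sub_nonneg.2 hε1)]
    have h5 := mul_le_mul_of_nonneg_left h4 hμ0
    linarith
  rw [min_eq_left hfin] at hl
  have hdec : frameMatrix v J - ((m / M * (ε ^ 2 / 12) : ℝ) : ℂ) • (1 : Matrix ι ι ℂ) =
      (frameMatrix v J - (l : ℂ) • (1 : Matrix ι ι ℂ)) +
        ((l - m / M * (ε ^ 2 / 12) : ℝ) : ℂ) • (1 : Matrix ι ι ℂ) := by
    rw [Complex.ofReal_sub, sub_smul]; abel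
  rw [hdec]
  exact hpos.posSemidef.add (PosSemidef.one.smul (Complex.zero_le_real.2 (sub_nonneg.2 hl)))

end Selection

/-- Vectors in `ℂᵐ` have the same frame quadratic forms as a Parseval frame of `ℂʳ`, `r ≤ m`. -/
lemma exists_parseval_frame {m M : ℕ} (y : Fin M → Fin m → ℂ) :
    ∃ r ≤ m, ∃ v : Fin M → Fin r → ℂ, frameMatrix v Finset.univ = 1 ∧
      ∀ a : Fin m → ℂ, ∃ c : Fin r → ℂ, ∀ i, star (y i) ⬝ᵥ a = star (v i) ⬝ᵥ c := by
  let T : (Fin m → ℂ) →ₗ[ℂ] EuclideanSpace ℂ (Fin M) :=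
    (WithLp.linearEquiv 2 ℂ (Fin M → ℂ)).symm.toLinearMap ∘ₗ
      (Matrix.of fun i => star (y i)).mulVecLin
  have hT : ∀ a i, T a i = star (y i) ⬝ᵥ a := fun a i => rfl
  let w := stdOrthonormalBasis ℂ (LinearMap.range T)
  refine ⟨_, (LinearMap.finrank_range_le T).trans (by simp),
    fun i j => star ((w j : EuclideanSpace ℂ (Fin M)) i), ?_, fun a => ?_⟩
  · ext j k
    have h := orthonormal_iff_ite.1 w.orthonormal j k
    rw [Submodule.coe_inner, PiLp.inner_apply] at h
    rw [frameMatrix, Matrix.sum_apply, one_apply, ← h]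
    refine Finset.sum_congr rfl fun i _ => ?_
    simp [vecMulVec_apply, mul_comm]
  · refine ⟨w.repr ⟨T a, a, rfl⟩, fun i => ?_⟩
    have h := congrArg (fun x : LinearMap.range T => (x : EuclideanSpace ℂ (Fin M)) i)
      (w.sum_repr ⟨T a, a, rfl⟩)
    simp only [hT] at h
    rw [← h]
    simp only [Submodule.coe_sum, Submodule.coe_smul, WithLp.ofLp_sum, WithLp.ofLp_smul,
      Finset.sum_apply, Pi.smul_apply, smul_eq_mul, dotProduct, Pi.star_apply, star_star]
    exact Finset.sum_congr rfl fun j _ => mul_comm _ _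

/-- Unweighted sparsification (Corollary `frame:smallb`). -/
theorem stmt_14 (m M : ℕ) (hm : 10 ≤ m) (y : Fin M → Fin m → ℂ)
    (b' : ℝ) (hb' : 1 + 10 / (m : ℝ) ≤ b') (hM : ⌈b' * m⌉₊ ≤ M) :
    ∃ J' : Finset (Fin M), J'.card ≤ ⌈b' * m⌉₊ ∧
      ∀ a : Fin m → ℂ,
        (1 / M) * ∑ i, ‖star (y i) ⬝ᵥ a‖ ^ 2 ≤
          432 * b' ^ 3 / (b' - 1) ^ 3 *
            ((1 / m) * ∑ i ∈ J', ‖star (y i) ⬝ᵥ a‖ ^ 2) := by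
  obtain ⟨r, hr, v, hv, hc⟩ := exists_parseval_frame y
  have hm0 : (0 : ℝ) < m := by exact_mod_cast (by lia : 0 < m)
  have hb : 0 < b' - 1 := by
    have : 0 < 10 / (m : ℝ) := by positivity
    linarith
  set ε : ℝ := min (b' - 1) 1 with hεdef
  have hε : 0 < ε := lt_min hb one_pos
  have hceil : b' * m ≤ ⌈b' * m⌉₊ := Nat.le_ceil _
  have hn : (1 + ε) * m ≤ ⌈b' * m⌉₊ := by
    refine le_trans ?_ hceil
    gcongr
    linarith [min_le_left (b' - 1) 1]
  obtain ⟨J, hJ, hpsd⟩ := exists_card_le_posSemidef hv hm (by simpa using hr) hε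
    (min_le_right _ _) hn (by simpa using hM)
  refine ⟨J, hJ, fun a => ?_⟩
  obtain ⟨c, hac⟩ := hc a
  simp only [hac]
  have hM0 : (0 : ℝ) < M := by
    have : (⌈b' * m⌉₊ : ℝ) ≤ M := by exact_mod_cast hM
    nlinarith
  have hquad := hpsd.re_dotProduct_nonneg c
  have huniv := re_dotProduct_frameMatrix_mulVec v Finset.univ c
  rw [hv, one_mulVec] at huniv
  rw [sub_mulVec, dotProduct_sub, smul_mulVec, one_mulVec, dotProduct_smul, map_sub,
    smul_eq_mul, RCLike.re_to_complex, RCLike.re_to_complex, Complex.re_ofReal_mul, huniv,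
    re_dotProduct_frameMatrix_mulVec, Fintype.card_fin, sub_nonneg] at hquad
  set X := ∑ i, ‖star (v i) ⬝ᵥ c‖ ^ 2
  set Y := ∑ i ∈ J, ‖star (v i) ⬝ᵥ c‖ ^ 2
  have hY : 0 ≤ Y := Finset.sum_nonneg fun i _ => by positivity
  have hconst : 12 / ε ^ 2 ≤ 432 * b' ^ 3 / (b' - 1) ^ 3 := by
    rw [div_le_div_iff₀ (by positivity) (by positivity)]
    have hcube : (b' - 1) ^ 3 ≤ b' ^ 3 := by gcongr; linarith
    have hb1 : b' ≤ b' ^ 3 := le_self_pow₀ (by linarith) (by norm_num)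
    rcases min_cases (b' - 1) 1 with ⟨h, -⟩ | ⟨h, -⟩
    · rw [hεdef, h]
      have : 12 * (b' - 1) ≤ 432 * b' ^ 3 := by linarith
      calc 12 * (b' - 1) ^ 3 = 12 * (b' - 1) * (b' - 1) ^ 2 := by ring
        _ ≤ 432 * b' ^ 3 * (b' - 1) ^ 2 := by gcongr
    · rw [hεdef, h]
      linarith
  calc 1 / M * X = 12 / ε ^ 2 * (1 / m * (m / M * (ε ^ 2 / 12) * X)) := by field_simp
    _ ≤ 12 / ε ^ 2 * (1 / m * Y) := by gcongr
    _ ≤ 432 * b' ^ 3 / (b' - 1) ^ 3 * (1 / m * Y) := by gcongr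
end
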